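/- arXiv:2605.02768 — 2 statements merged into one kernel-verified Lean document; each statement's English description precedes it below -/
import Mathlib

section
/- For every even integer q ≥ 2 and every z ∈ ℂ with |z| ≤ e⁻², one has ℛ(z) = Σ_{v≥1} (z^v/v!) Σ_{T ∈ 𝒯_v} v · b_T and ℰ(z) = Σ_{v≥1} (z^v/v!) Σ_{T ∈ 𝒯_v} ((v−1)/(q−1)) · b_T, where an inner sum over an empty set 𝒯_v is 0. -/
open MeasureTheory Filter

noncomputable section

namespace SYK

attribute [local instance] Classical.propDecidable

/-- The chord crossing sign `K(x,y)`. -/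
def K (x y : ℝ × ℝ) : ℝ :=
  if (x.1 < y.1 ∧ y.1 < x.2 ∧ x.2 < y.2) ∨ (y.1 < x.1 ∧ x.1 < y.2 ∧ y.2 < x.2) then -1 else 1

lemma K_symm (x y : ℝ × ℝ) : K x y = K y x := if_congr or_comm rfl rfl

/-- The law of `(min U₁ U₂, max U₁ U₂)` for `U₁, U₂` i.i.d. uniform on `[0,1]`. -/
def nu : Measure (ℝ × ℝ) :=
  Measure.map (fun p : ℝ × ℝ => (min p.1 p.2, max p.1 p.2))
    (volume.restrict (Set.Icc (0 : ℝ) 1 ×ˢ Set.Icc (0 : ℝ) 1))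

/-- `Ω = [0,1]²`. -/
def Omega : Set (ℝ × ℝ) := Set.Icc (0 : ℝ) 1 ×ˢ Set.Icc (0 : ℝ) 1

/-- The closed disk `{z : |z| ≤ e⁻²}`. -/
def De : Set ℂ := Metric.closedBall 0 (Real.exp (-2))

/-- Membership in `ℱ_{e,Ω}`: continuous on the domain and bounded by `1` there. -/
def memF (G : ℂ → ℝ × ℝ → ℂ) : Prop :=
  ContinuousOn (fun p : ℂ × (ℝ × ℝ) => G p.1 p.2) (De ×ˢ Omega) ∧
    ∀ z ∈ De, ∀ x ∈ Omega, ‖G z x‖ ≤ 1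

/-- `∏_{1 ≤ i < j ≤ d} K(y_i, y_j)`. -/
def pairProd (d : ℕ) (y : Fin d → ℝ × ℝ) : ℝ :=
  ∏ p ∈ Finset.univ.filter (fun p : Fin d × Fin d => p.1 < p.2), K (y p.1) (y p.2)

/-- The `d`-th term of the series defining the operator `𝒯`. -/
def Tterm (q : ℕ) (G : ℂ → ℝ × ℝ → ℂ) (z : ℂ) (x : ℝ × ℝ) (d : ℕ) : ℂ :=
  ((d.factorial : ℂ))⁻¹ *
    ∫ y : Fin d → ℝ × ℝ,
      (∏ i, ((K x (y i) : ℂ) * (G z (y i)) ^ (q - 1) / ((q - 1).factorial : ℂ))) *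
        (pairProd d y : ℂ) ∂(Measure.pi fun _ => nu)

/-- The operator `𝒯` (Chord-Cavity operator). -/
def Tcal (q : ℕ) (G : ℂ → ℝ × ℝ → ℂ) (z : ℂ) (x : ℝ × ℝ) : ℂ :=
  z + z * ∑' d : ℕ, Tterm q G z x (d + 1)

/-- `H` is a Chord-Cavity-Generator: it lies in `ℱ_{e,Ω}` and satisfies the
fixed point equation on the domain. -/
def IsCCG (q : ℕ) (H : ℂ → ℝ × ℝ → ℂ) : Prop :=
  memF H ∧ ∀ z ∈ De, ∀ x ∈ Omega, H z x = Tcal q H z x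

/-- Two vertices are related if some hyperedge of `E` contains both. -/
def edgeRel {N : ℕ} (E : Finset (Finset (Fin N))) (a b : Fin N) : Prop :=
  ∃ e ∈ E, a ∈ e ∧ b ∈ e

/-- A hypergraph on the full vertex set `Fin N` is connected. -/
def HGConnected {N : ℕ} (E : Finset (Finset (Fin N))) : Prop :=
  ∀ a b : Fin N, Relation.ReflTransGen (edgeRel E) a b

/-- `E` is a `q`-uniform hypertree on the vertex set `Fin N`. -/
def IsHypertree (q N : ℕ) (E : Finset (Finset (Fin N))) : Prop :=
  (∀ e ∈ E, e.card = q) ∧ HGConnected E ∧ (q - 1) * E.card = N - 1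

/-- The set `𝒯_N` of `q`-uniform hypertrees on `{1,…,N}`. -/
def trees (q N : ℕ) : Finset (Finset (Finset (Fin N))) :=
  Finset.univ.filter (IsHypertree q N)

/-- Sign contributed by an unordered pair of hyperedges with chords given by `X`. -/
def pairSign {N : ℕ} (X : Finset (Fin N) → ℝ × ℝ) : Sym2 (Finset (Fin N)) → ℝ :=
  Sym2.lift ⟨fun e₁ e₂ => if Odd (e₁ ∩ e₂).card then K (X e₁) (X e₂) else 1,
    fun e₁ e₂ => if_congr (by rw [Finset.inter_comm]) (K_symm _ _) rfl⟩

/-- `B_H(X)`: the product of `K(X(e₁),X(e₂))` over unordered pairs of distinct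
hyperedges sharing an odd number of vertices. -/
def BE {N : ℕ} (E : Finset (Finset (Fin N))) (X : Finset (Fin N) → ℝ × ℝ) : ℝ :=
  ∏ p ∈ E.sym2.filter (fun p => ¬ p.IsDiag), pairSign X p

/-- `b_H`: the expectation of `B_H(X)` over i.i.d. chords with law `ν`. -/
def bT {N : ℕ} (E : Finset (Finset (Fin N))) : ℝ :=
  ∫ X : Finset (Fin N) → ℝ × ℝ, BE E X ∂(Measure.pi fun _ => nu)

/-- The `d`-th term of the series defining `ℛ`. -/
def Rterm (q : ℕ) (H : ℂ → ℝ × ℝ → ℂ) (z : ℂ) (d : ℕ) : ℂ :=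
  ((d.factorial : ℂ))⁻¹ *
    ∫ y : Fin d → ℝ × ℝ,
      (∏ i, ((H z (y i)) ^ (q - 1) / ((q - 1).factorial : ℂ))) *
        (pairProd d y : ℂ) ∂(Measure.pi fun _ => nu)

/-- `ℛ(z)`, defined from a CCG `H`. -/
def Rcal (q : ℕ) (H : ℂ → ℝ × ℝ → ℂ) (z : ℂ) : ℂ :=
  z + z * ∑' d : ℕ, Rterm q H z (d + 1)

/-- `ℰ(z) = (1/q!) ∫ H(z,x)^q dν(x)`. -/
def Ecal (q : ℕ) (H : ℂ → ℝ × ℝ → ℂ) (z : ℂ) : ℂ :=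
  ((q.factorial : ℂ))⁻¹ * ∫ x, (H z x) ^ q ∂nu

/-- Hypertrees on the vertex subset `A` of `Fin n`. -/
def treesOn (q : ℕ) {n : ℕ} (A : Finset (Fin n)) : Finset (Finset (Finset (Fin n))) :=
  Finset.univ.filter fun E => (∀ e ∈ E, e ⊆ A ∧ e.card = q) ∧
    (∀ a ∈ A, ∀ b ∈ A, Relation.ReflTransGen (edgeRel E) a b) ∧ (q - 1) * E.card + 1 = A.card

lemma mem_treesOn {q n : ℕ} {A : Finset (Fin n)} {E : Finset (Finset (Fin n))} :
    E ∈ treesOn q A ↔ (∀ e ∈ E, e ⊆ A ∧ e.card = q) ∧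
      (∀ a ∈ A, ∀ b ∈ A, Relation.ReflTransGen (edgeRel E) a b) ∧
        (q - 1) * E.card + 1 = A.card := by
  simp [treesOn]

/-- Rooted hypertrees on the vertex subset `A`. -/
def rootedOn (q : ℕ) {n : ℕ} (A : Finset (Fin n)) : Finset (Fin n × Finset (Finset (Fin n))) :=
  A ×ˢ treesOn q A

lemma mem_rootedOn {q n : ℕ} {A : Finset (Fin n)} {p : Fin n × Finset (Finset (Fin n))} :
    p ∈ rootedOn q A ↔ p.1 ∈ A ∧ p.2 ∈ treesOn q A := Finset.mem_product

lemma trees_succ (q v : ℕ) : trees q (v + 1) = treesOn q (Finset.univ : Finset (Fin (v + 1))) := by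
  ext E
  simp [trees, mem_treesOn, IsHypertree, HGConnected]

lemma edgeRel_mono {n : ℕ} {E F : Finset (Finset (Fin n))} (h : E ⊆ F) {a b : Fin n}
    (hab : edgeRel E a b) : edgeRel F a b := by
  obtain ⟨e, he, h1⟩ := hab
  exact ⟨e, h he, h1⟩

lemma reach_mono {n : ℕ} {E F : Finset (Finset (Fin n))} (h : E ⊆ F) {a b : Fin n}
    (hab : Relation.ReflTransGen (edgeRel E) a b) : Relation.ReflTransGen (edgeRel F) a b :=
  hab.lift id fun _ _ => edgeRel_mono h

lemma reach_symm {n : ℕ} {E : Finset (Finset (Fin n))} {a b : Fin n}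
    (hab : Relation.ReflTransGen (edgeRel E) a b) : Relation.ReflTransGen (edgeRel E) b a := by
  have : Std.Symm (edgeRel E) := ⟨fun a b ⟨e, he, h1, h2⟩ => ⟨e, he, h2, h1⟩⟩
  exact Std.Symm.symm _ _ hab

/-- A function constant on every hyperedge is constant along paths. -/
lemma eq_of_reach {n : ℕ} {α : Type*} {E : Finset (Finset (Fin n))} (c : Fin n → α)
    (hc : ∀ e ∈ E, ∀ a ∈ e, ∀ b ∈ e, c a = c b) {a b : Fin n}
    (hab : Relation.ReflTransGen (edgeRel E) a b) : c a = c b := by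
  induction hab with
  | refl => rfl
  | tail _ h ih =>
    obtain ⟨e, he, h1, h2⟩ := h
    exact ih.trans (hc e he _ h1 _ h2)

/-- If every vertex of `A` can be reached from `S`, then `|A| ≤ |S| + (q - 1) |E|`. -/
lemma card_le_of_reach {q n : ℕ} (hq : 1 ≤ q) (m : ℕ) : ∀ (E : Finset (Finset (Fin n)))
    (A S : Finset (Fin n)), E.card = m → (∀ e ∈ E, e.card = q) →
    (∀ v ∈ A, ∃ s ∈ S, Relation.ReflTransGen (edgeRel E) s v) →
    A.card ≤ S.card + (q - 1) * m := by
  induction m with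
  | zero =>
    intro E A S hE _ hr
    have hE : E = ∅ := Finset.card_eq_zero.mp hE
    subst hE
    rw [mul_zero, add_zero]
    apply Finset.card_le_card
    intro v hv
    obtain ⟨s, hs, h⟩ := hr v hv
    have := eq_of_reach (E := ∅) id (by simp) h
    simp only [id] at this
    exact this ▸ hs
  | succ m ih =>
    intro E A S hE hu hr
    by_cases hAS : A ⊆ S
    · exact (Finset.card_le_card hAS).trans (Nat.le_add_right _ _)
    · obtain ⟨v, hvA, hvS⟩ := Finset.not_subset.mp hAS
      have key : ∃ e ∈ E, (e ∩ S).Nonempty := by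
        by_contra hcon
        push Not at hcon
        obtain ⟨s, hs, h⟩ := hr v hvA
        have : (s ∈ S) = (v ∈ S) := by
          refine eq_of_reach (E := E) (fun a => a ∈ S) ?_ h
          intro e he a ha b hb
          have h0 := hcon e he
          have h1 : a ∉ S := fun h => by
            have : a ∈ e ∩ S := Finset.mem_inter.mpr ⟨ha, h⟩
            rw [h0] at this; simp at this
          have h2 : b ∉ S := fun h => by
            have : b ∈ e ∩ S := Finset.mem_inter.mpr ⟨hb, h⟩
            rw [h0] at this; simp at this
          simp [h1, h2]
        exact hvS (this ▸ hs)
      obtain ⟨e, he, hne⟩ := key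
      have h1 := ih (E.erase e) A (S ∪ e) (by rw [Finset.card_erase_of_mem he, hE]; rfl)
        (fun f hf => hu f (Finset.mem_of_mem_erase hf)) ?_
      · have h2 := Finset.card_union_add_card_inter S e
        have h3 : 1 ≤ (S ∩ e).card := by
          rw [Finset.inter_comm]; exact Finset.card_pos.mpr hne
        rw [hu e he] at h2
        have : (q - 1) * (m + 1) = (q - 1) * m + (q - 1) := by ring
        omega
      · intro w hw
        obtain ⟨s, hs, h⟩ := hr w hw
        have hsS : s ∈ S ∪ e := Finset.mem_union_left _ hs
        clear hw hs
        induction h with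
        | refl => exact ⟨s, hsS, Relation.ReflTransGen.refl⟩
        | @tail b c _ hbc ih2 =>
          obtain ⟨f, hf, hbf, hcf⟩ := hbc
          by_cases hfe : f = e
          · subst hfe
            exact ⟨c, Finset.mem_union_right _ hcf, Relation.ReflTransGen.refl⟩
          · obtain ⟨s', hs', h'⟩ := ih2
            exact ⟨s', hs', h'.tail ⟨f, Finset.mem_erase.mpr ⟨hfe, hf⟩, hbf, hcf⟩⟩

/-- The colour class of `i`. -/
def fib {n : ℕ} {ι : Type*} [DecidableEq ι] (c : Fin n → ι) (i : ι) : Finset (Fin n) :=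
  Finset.univ.filter fun v => c v = i

lemma mem_fib {n : ℕ} {ι : Type*} [DecidableEq ι] {c : Fin n → ι} {i : ι} {v : Fin n} :
    v ∈ fib c i ↔ c v = i := by simp [fib]

/-- The hyperedge through the roots of a family of rooted hypergraphs. -/
def rootEdge {q n : ℕ} (P : Fin q → Fin n × Finset (Finset (Fin n))) : Finset (Fin n) :=
  Finset.univ.image fun i => (P i).1

/-- The union of a family of rooted hypergraphs. -/
def unionTrees {q n : ℕ} (P : Fin q → Fin n × Finset (Finset (Fin n))) :
    Finset (Finset (Fin n)) :=
  Finset.univ.biUnion fun i => (P i).2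

/-- The hypergraph obtained by joining a family of rooted hypergraphs along a new hyperedge
through the roots. -/
def joinTrees {q n : ℕ} (P : Fin q → Fin n × Finset (Finset (Fin n))) :
    Finset (Finset (Fin n)) :=
  insert (rootEdge P) (unionTrees P)

/-- A family of rooted hypertrees on the colour classes of `c`. -/
def IsFamily {q n : ℕ} (c : Fin n → Fin q) (P : Fin q → Fin n × Finset (Finset (Fin n))) : Prop :=
  ∀ i, P i ∈ rootedOn q (fib c i)

namespace IsFamily

variable {q n : ℕ} {c : Fin n → Fin q} {P : Fin q → Fin n × Finset (Finset (Fin n))}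

lemma color_root (h : IsFamily c P) (i : Fin q) : c (P i).1 = i :=
  mem_fib.mp (mem_rootedOn.mp (h i)).1

lemma tree (h : IsFamily c P) (i : Fin q) : (P i).2 ∈ treesOn q (fib c i) :=
  (mem_rootedOn.mp (h i)).2

lemma color_edge (h : IsFamily c P) {i : Fin q} {e : Finset (Fin n)} (he : e ∈ (P i).2)
    {v : Fin n} (hv : v ∈ e) : c v = i :=
  mem_fib.mp (((mem_treesOn.mp (h.tree i)).1 e he).1 hv)

lemma root_injective (h : IsFamily c P) : Function.Injective fun i => (P i).1 := by
  intro i j hij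
  rw [← h.color_root i, ← h.color_root j]
  exact congrArg c hij

lemma card_rootEdge (h : IsFamily c P) : (rootEdge P).card = q := by
  rw [rootEdge, Finset.card_image_of_injective _ h.root_injective]; simp

lemma mem_rootEdge (h : IsFamily c P) {v : Fin n} : v ∈ rootEdge P ↔ (P (c v)).1 = v := by
  simp only [rootEdge, Finset.mem_image, Finset.mem_univ, true_and]
  constructor
  · rintro ⟨i, rfl⟩; rw [h.color_root]
  · intro hv; exact ⟨_, hv⟩

lemma edge_nonempty (hq : 2 ≤ q) (h : IsFamily c P) {i : Fin q} {e : Finset (Fin n)}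
    (he : e ∈ (P i).2) : e.Nonempty := by
  apply Finset.card_pos.mp
  rw [((mem_treesOn.mp (h.tree i)).1 e he).2]; omega

lemma rootEdge_notMem (hq : 2 ≤ q) (h : IsFamily c P) : rootEdge P ∉ unionTrees P := by
  intro hm
  simp only [unionTrees, Finset.mem_biUnion, Finset.mem_univ, true_and] at hm
  obtain ⟨i, hi⟩ := hm
  have h0 : ∀ j, j = i := fun j => by
    have := h.color_edge hi (v := (P j).1) (by simp [rootEdge])
    rwa [h.color_root] at this
  have h1 := h0 ⟨0, by omega⟩
  have h2 := h0 ⟨1, by omega⟩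
  rw [← h2] at h1
  simp at h1

lemma disjoint (hq : 2 ≤ q) (h : IsFamily c P) {i j : Fin q} (hij : i ≠ j) :
    Disjoint (P i).2 (P j).2 := by
  rw [Finset.disjoint_left]
  intro e hi hj
  obtain ⟨v, hv⟩ := h.edge_nonempty hq hi
  exact hij ((h.color_edge hi hv).symm.trans (h.color_edge hj hv))

lemma card_joinTrees (hq : 2 ≤ q) (h : IsFamily c P) :
    (joinTrees P).card = 1 + ∑ i, ((P i).2).card := by
  rw [joinTrees, Finset.card_insert_of_notMem (h.rootEdge_notMem hq), unionTrees,
    Finset.card_biUnion, add_comm]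
  exact fun i _ j _ hij => h.disjoint hq hij

lemma subset_joinTrees (i : Fin q) : (P i).2 ⊆ joinTrees P :=
  (Finset.subset_biUnion_of_mem (fun i => (P i).2) (Finset.mem_univ i)).trans
    (Finset.subset_insert _ _)

lemma reach_root (h : IsFamily c P) (v : Fin n) :
    Relation.ReflTransGen (edgeRel (P (c v)).2) (P (c v)).1 v := by
  refine (mem_treesOn.mp (h.tree (c v))).2.1 _ ?_ _ ?_
  · rw [mem_fib, h.color_root]
  · rw [mem_fib]

lemma sum_card_fib {q n : ℕ} (c : Fin n → Fin q) : ∑ i, (fib c i).card = n := by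
  have := Finset.card_eq_sum_card_fiberwise (f := c) (s := Finset.univ) (t := Finset.univ)
    (fun x _ => Finset.mem_coe.mpr (Finset.mem_univ _))
  simpa [fib] using this.symm

lemma joinTrees_mem (hq : 2 ≤ q) (h : IsFamily c P) :
    joinTrees P ∈ treesOn q (Finset.univ : Finset (Fin n)) := by
  refine mem_treesOn.mpr ⟨?_, ?_, ?_⟩
  · intro e he
    refine ⟨Finset.subset_univ _, ?_⟩
    rcases Finset.mem_insert.mp he with rfl | he
    · exact h.card_rootEdge
    · simp only [unionTrees, Finset.mem_biUnion, Finset.mem_univ, true_and] at he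
      obtain ⟨i, hi⟩ := he
      exact ((mem_treesOn.mp (h.tree i)).1 e hi).2
  · intro a _ b _
    have h1 : ∀ v, Relation.ReflTransGen (edgeRel (joinTrees P)) (P (c v)).1 v := fun v =>
      reach_mono (subset_joinTrees _) (h.reach_root v)
    refine (reach_symm (h1 a)).trans (Relation.ReflTransGen.head ?_ (h1 b))
    exact ⟨rootEdge P, Finset.mem_insert_self _ _, by simp [rootEdge], by simp [rootEdge]⟩
  · rw [h.card_joinTrees hq, Finset.card_univ, Fintype.card_fin]
    have h1 : ∑ i, ((q - 1) * ((P i).2).card + 1) = ∑ i, (fib c i).card :=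
      Finset.sum_congr rfl fun i _ => (mem_treesOn.mp (h.tree i)).2.2
    rw [sum_card_fib, Finset.sum_add_distrib, ← Finset.mul_sum] at h1
    simp at h1
    rw [mul_add]
    omega

lemma eq_color (h : IsFamily c P) {c' : Fin n → Fin q}
    {P' : Fin q → Fin n × Finset (Finset (Fin n))} (h' : IsFamily c' P')
    (hr : ∀ i, (P i).1 = (P' i).1) (hu : unionTrees P = unionTrees P') : c = c' := by
  funext v
  have h1 : Relation.ReflTransGen (edgeRel (unionTrees P)) (P (c v)).1 v :=
    reach_mono (Finset.subset_biUnion_of_mem (fun i => (P i).2) (Finset.mem_univ _))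
      (h.reach_root v)
  rw [hu] at h1
  have h2 := eq_of_reach c' ?_ h1
  · rw [hr, h'.color_root] at h2; exact h2
  · intro e he a ha b hb
    simp only [unionTrees, Finset.mem_biUnion, Finset.mem_univ, true_and] at he
    obtain ⟨i, hi⟩ := he
    rw [h'.color_edge hi ha, h'.color_edge hi hb]

lemma tree_eq (hq : 2 ≤ q) (h : IsFamily c P) (i : Fin q) :
    (P i).2 = (unionTrees P).filter fun e => e ⊆ fib c i := by
  ext e
  simp only [unionTrees, Finset.mem_filter, Finset.mem_biUnion, Finset.mem_univ, true_and]
  constructor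
  · intro he
    exact ⟨⟨i, he⟩, fun v hv => mem_fib.mpr (h.color_edge he hv)⟩
  · rintro ⟨⟨j, hj⟩, hs⟩
    obtain ⟨v, hv⟩ := h.edge_nonempty hq hj
    have h1 := h.color_edge hj hv
    rw [mem_fib.mp (hs hv)] at h1
    exact h1 ▸ hj

lemma erase_joinTrees (hq : 2 ≤ q) (h : IsFamily c P) :
    (joinTrees P).erase (rootEdge P) = unionTrees P :=
  Finset.erase_insert (h.rootEdge_notMem hq)

lemma injective (hq : 2 ≤ q) (h : IsFamily c P) {c' : Fin n → Fin q}
    {P' : Fin q → Fin n × Finset (Finset (Fin n))} (h' : IsFamily c' P')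
    (hr : ∀ i, (P i).1 = (P' i).1) (hu : joinTrees P = joinTrees P') : c = c' ∧ P = P' := by
  have he : rootEdge P = rootEdge P' := by simp [rootEdge, hr]
  have hu' : unionTrees P = unionTrees P' := by
    rw [← h.erase_joinTrees hq, ← h'.erase_joinTrees hq, hu, he]
  have hc := h.eq_color h' hr hu'
  subst hc
  refine ⟨rfl, funext fun i => Prod.ext (hr i) ?_⟩
  rw [h.tree_eq hq, h'.tree_eq hq, hu']

end IsFamily

/-- Removing a hyperedge from a hypertree leaves a family of rooted hypertrees. -/
lemma exists_family {q n : ℕ} (hq : 2 ≤ q) {E : Finset (Finset (Fin n))}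
    (hE : E ∈ treesOn q (Finset.univ : Finset (Fin n))) (f : Fin q → Fin n)
    (hf : Function.Injective f) (he : Finset.univ.image f ∈ E) :
    ∃ c P, IsFamily c P ∧ joinTrees P = E ∧ ∀ i, (P i).1 = f i := by
  obtain ⟨hu, hr, hcard⟩ := mem_treesOn.mp hE
  set e := Finset.univ.image f with hedef
  set E' := E.erase e with hE'
  have hcardE' : E'.card + 1 = E.card := Finset.card_erase_add_one he
  have hcard' : n = q + (q - 1) * E'.card := by
    rw [← hcardE', Finset.card_univ, Fintype.card_fin] at hcard
    have : (q - 1) * (E'.card + 1) = (q - 1) * E'.card + (q - 1) := by ring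
    omega
  have hu' : ∀ g ∈ E', g.card = q := fun g hg => (hu g (Finset.mem_of_mem_erase hg)).2
  have hreach : ∀ v, ∃ i, Relation.ReflTransGen (edgeRel E') (f i) v := by
    intro v
    have h := hr (f ⟨0, by omega⟩) (Finset.mem_univ _) v (Finset.mem_univ _)
    induction h with
    | refl => exact ⟨_, Relation.ReflTransGen.refl⟩
    | @tail b d _ hbd ih =>
      obtain ⟨g, hg, hb, hd⟩ := hbd
      by_cases hge : g = e
      · subst hge
        rw [hedef, Finset.mem_image] at hd
        obtain ⟨i, -, rfl⟩ := hd
        exact ⟨i, Relation.ReflTransGen.refl⟩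
      · obtain ⟨i, hi⟩ := ih
        exact ⟨i, hi.tail ⟨g, Finset.mem_erase.mpr ⟨hge, hg⟩, hb, hd⟩⟩
  have hsep : ∀ i j, Relation.ReflTransGen (edgeRel E') (f i) (f j) → i = j := by
    intro i j hij
    by_contra hne
    have h1 := card_le_of_reach (q := q) (by omega) E'.card E' Finset.univ
      ((Finset.univ.erase j).image f) rfl hu' ?_
    · rw [Finset.card_image_of_injective _ hf, Finset.card_erase_of_mem (Finset.mem_univ _)] at h1
      simp only [Finset.card_univ, Fintype.card_fin] at h1
      omega
    · intro v _
      obtain ⟨k, hk⟩ := hreach v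
      by_cases hkj : k = j
      · subst hkj
        exact ⟨f i, Finset.mem_image_of_mem _ (by simp [hne]), hij.trans hk⟩
      · exact ⟨f k, Finset.mem_image_of_mem _ (by simp [hkj]), hk⟩
  choose c hc using hreach
  have hcf : ∀ i, c (f i) = i := fun i => hsep _ _ (hc (f i))
  have hmono : ∀ g ∈ E', ∀ a ∈ g, ∀ b ∈ g, c a = c b := by
    intro g hg a ha b hb
    refine hsep _ _ ((hc a).trans (Relation.ReflTransGen.head ?_ (reach_symm (hc b))))
    exact ⟨g, hg, ha, hb⟩
  let T : Fin q → Finset (Finset (Fin n)) := fun i => E'.filter fun g => g ⊆ fib c i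
  have hTreach : ∀ v, Relation.ReflTransGen (edgeRel (T (c v))) (f (c v)) v := by
    intro v
    have h := hc v
    generalize f (c v) = a at h
    induction h using Relation.ReflTransGen.head_induction_on with
    | refl => exact Relation.ReflTransGen.refl
    | @head a b hab hbv ih =>
      refine Relation.ReflTransGen.head ?_ ih
      obtain ⟨g, hg, hag, hbg⟩ := hab
      refine ⟨g, Finset.mem_filter.mpr ⟨hg, fun w hw => mem_fib.mpr ?_⟩, hag, hbg⟩
      rw [hmono g hg w hw b hbg]
      exact eq_of_reach c hmono hbv
  have hTcard : ∀ i, (fib c i).card ≤ 1 + (q - 1) * (T i).card := by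
    intro i
    refine card_le_of_reach (q := q) (by omega) _ (T i) (fib c i) {f i} rfl
      (fun g hg => hu' g (Finset.mem_filter.mp hg).1) ?_
    intro v hv
    rw [mem_fib] at hv
    subst hv
    exact ⟨_, Finset.mem_singleton_self _, hTreach v⟩
  have hTdisj : ∀ i ∈ (Finset.univ : Finset (Fin q)), ∀ j ∈ (Finset.univ : Finset (Fin q)),
      i ≠ j → Disjoint (T i) (T j) := by
    intro i _ j _ hij
    rw [Finset.disjoint_left]
    intro g hg hg'
    obtain ⟨hgE, hgi⟩ := Finset.mem_filter.mp hg
    obtain ⟨v, hv⟩ : g.Nonempty := Finset.card_pos.mp (by rw [hu' g hgE]; omega)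
    exact hij ((mem_fib.mp (hgi hv)).symm.trans
      (mem_fib.mp ((Finset.mem_filter.mp hg').2 hv)))
  have hTunion : Finset.univ.biUnion T = E' := by
    ext g
    simp only [Finset.mem_biUnion, Finset.mem_univ, true_and, T, Finset.mem_filter]
    constructor
    · rintro ⟨i, h, -⟩; exact h
    · intro hg
      obtain ⟨v, hv⟩ : g.Nonempty := Finset.card_pos.mp (by rw [hu' g hg]; omega)
      exact ⟨c v, hg, fun w hw => mem_fib.mpr (hmono g hg w hw v hv)⟩
  have hsum : ∑ i, (1 + (q - 1) * (T i).card) = ∑ i, (fib c i).card := by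
    rw [IsFamily.sum_card_fib, Finset.sum_add_distrib, ← Finset.mul_sum,
      ← Finset.card_biUnion hTdisj, hTunion]
    simp
    omega
  have heq : ∀ i, (fib c i).card = 1 + (q - 1) * (T i).card := fun i =>
    (Finset.sum_eq_sum_iff_of_le (fun i _ => hTcard i)).mp hsum.symm i (Finset.mem_univ i)
  refine ⟨c, fun i => (f i, T i), fun i => ?_, ?_, fun _ => rfl⟩
  · refine mem_rootedOn.mpr ⟨mem_fib.mpr (hcf i), mem_treesOn.mpr ⟨?_, ?_, ?_⟩⟩
    · intro g hg
      obtain ⟨hgE, hgi⟩ := Finset.mem_filter.mp hg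
      exact ⟨hgi, hu' g hgE⟩
    · intro a ha b hb
      rw [mem_fib] at ha hb
      have h1 := hTreach a
      have h2 := hTreach b
      rw [ha] at h1
      rw [hb] at h2
      exact (reach_symm h1).trans h2
    · rw [heq]; ring
  · have : joinTrees (fun i => (f i, T i)) = insert e (Finset.univ.biUnion T) := rfl
    rw [this, hTunion, hE', Finset.insert_erase he]

/-- The number of hyperedges at the root. -/
def rootDeg {n : ℕ} (p : Fin n × Finset (Finset (Fin n))) : ℕ :=
  (p.2.filter fun e => p.1 ∈ e).card

lemma sum_perm_apply_zero (k : ℕ) (g : Fin (k + 1) → ℝ) :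
    ∑ σ : Equiv.Perm (Fin (k + 1)), g (σ 0) = (k.factorial : ℝ) * ∑ i, g i := by
  rw [← Equiv.sum_comp (Equiv.Perm.decomposeFin (n := k)).symm, Fintype.sum_prod_type]
  simp [Finset.mul_sum, Fintype.card_perm]

/-- Summing over the enumerations of a hyperedge. -/
lemma sum_enumerations {n : ℕ} (k : ℕ) (e : Finset (Fin n)) (he : e.card = k + 1)
    (g : Fin n → ℝ) :
    ∑ f ∈ Finset.univ.filter (fun f : Fin (k + 1) → Fin n =>
      Function.Injective f ∧ Finset.univ.image f = e), g (f 0) =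
      (k.factorial : ℝ) * ∑ r ∈ e, g r := by
  set ι := e.orderEmbOfFin he with hι
  have himg : Finset.univ.image ι = e := Finset.image_orderEmbOfFin_univ e he
  have h1 : ∑ r ∈ e, g r = ∑ i, g (ι i) := by
    conv_lhs => rw [← himg]
    exact Finset.sum_image fun a _ b _ h => ι.injective h
  rw [h1, ← sum_perm_apply_zero k fun i => g (ι i)]
  symm
  refine Finset.sum_nbij (fun σ i => ι (σ i)) ?_ ?_ ?_ fun _ _ => rfl
  · intro σ _
    refine Finset.mem_filter.mpr ⟨Finset.mem_univ _, ι.injective.comp σ.injective, ?_⟩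
    have : (Finset.univ.image fun i => ι (σ i)) = (Finset.univ.image σ).image ι := by
      rw [Finset.image_image]; rfl
    rw [this, Finset.image_univ_equiv, himg]
  · intro σ _ τ _ h
    exact Equiv.ext fun i => ι.injective (congrFun h i)
  · intro f hf
    obtain ⟨-, hinj, hfe⟩ := Finset.mem_filter.mp (Finset.mem_coe.mp hf)
    have hex : ∀ i, ∃ j, ι j = f i := fun i => by
      have : f i ∈ Finset.univ.image ι := by
        rw [himg, ← hfe]; exact Finset.mem_image_of_mem _ (Finset.mem_univ _)
      simpa using this
    choose s hs using hex
    have hsi : Function.Injective s := fun a b hab => hinj (by rw [← hs, ← hs, hab])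
    refine ⟨Equiv.ofBijective s (Finite.injective_iff_bijective.mp hsi), Finset.mem_coe.mpr
      (Finset.mem_univ _), funext fun i => hs i⟩

lemma sum_flags {n : ℕ} (k : ℕ) (hk : 1 ≤ k) (Φ : Fin n × Finset (Finset (Fin n)) → ℝ) :
    (∑ c : Fin n → Fin (k + 1),
      ∑ P ∈ Fintype.piFinset fun i => rootedOn (k + 1) (fib c i), Φ ((P 0).1, joinTrees P)) =
    ∑ E ∈ treesOn (k + 1) (Finset.univ : Finset (Fin n)),
      ∑ f ∈ Finset.univ.filter (fun f : Fin (k + 1) → Fin n =>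
        Function.Injective f ∧ Finset.univ.image f ∈ E), Φ (f 0, E) := by
  rw [Finset.sum_sigma', Finset.sum_sigma']
  have hfam : ∀ x : (_ : Fin n → Fin (k + 1)) × (Fin (k + 1) → Fin n × Finset (Finset (Fin n))),
      x ∈ (Finset.univ.sigma fun c : Fin n → Fin (k + 1) =>
        Fintype.piFinset fun i => rootedOn (k + 1) (fib c i)) ↔ IsFamily x.1 x.2 := by
    intro x
    simp [IsFamily, Fintype.mem_piFinset]
  refine Finset.sum_nbij (fun x => ⟨joinTrees x.2, fun i => (x.2 i).1⟩) ?_ ?_ ?_ fun _ _ => rfl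
  · intro x hx
    rw [hfam] at hx
    simp only [Finset.mem_sigma, Finset.mem_filter, Finset.mem_univ, true_and]
    exact ⟨hx.joinTrees_mem (by omega), hx.root_injective, Finset.mem_insert_self _ _⟩
  · rintro ⟨c, P⟩ hx ⟨c', P'⟩ hy h
    rw [Finset.mem_coe, hfam] at hx hy
    simp only [Sigma.mk.injEq, heq_eq_eq] at h
    obtain ⟨rfl, rfl⟩ := hx.injective (by omega) hy (congrFun h.2) h.1
    rfl
  · rintro ⟨E, f⟩ hx
    simp only [Finset.coe_sigma, Set.mem_sigma_iff, Finset.mem_coe, Finset.mem_filter,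
      Finset.mem_univ, true_and] at hx
    obtain ⟨c, P, h1, h2, h3⟩ := exists_family (by omega) hx.1 f hx.2.1 hx.2.2
    refine ⟨⟨c, P⟩, Finset.mem_coe.mpr ((hfam _).mpr h1), ?_⟩
    simp only [Sigma.mk.injEq, heq_eq_eq]
    exact ⟨h2, funext h3⟩

/-- The decomposition of rooted hypertrees along a hyperedge at the root. -/
lemma sum_rootDeg {n : ℕ} (k : ℕ) (hk : 1 ≤ k) (Φ : Fin n × Finset (Finset (Fin n)) → ℝ) :
    (k.factorial : ℝ) * ∑ p ∈ rootedOn (k + 1) (Finset.univ : Finset (Fin n)),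
      (rootDeg p : ℝ) * Φ p =
    ∑ c : Fin n → Fin (k + 1),
      ∑ P ∈ Fintype.piFinset fun i => rootedOn (k + 1) (fib c i), Φ ((P 0).1, joinTrees P) := by
  rw [sum_flags k hk, rootedOn, Finset.sum_product_right, Finset.mul_sum]
  refine Finset.sum_congr rfl fun E hE => ?_
  have h1 : (Finset.univ.filter fun f : Fin (k + 1) → Fin n =>
      Function.Injective f ∧ Finset.univ.image f ∈ E) = E.biUnion fun e =>
        Finset.univ.filter fun f : Fin (k + 1) → Fin n =>
          Function.Injective f ∧ Finset.univ.image f = e := by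
    ext f; simp [and_comm]
  rw [h1, Finset.sum_biUnion]
  · have h2 : ∀ e ∈ E, ∑ f ∈ Finset.univ.filter (fun f : Fin (k + 1) → Fin n =>
        Function.Injective f ∧ Finset.univ.image f = e), Φ (f 0, E) =
          (k.factorial : ℝ) * ∑ r ∈ e, Φ (r, E) := fun e he =>
      sum_enumerations k e (((mem_treesOn.mp hE).1 e he).2) fun r => Φ (r, E)
    rw [Finset.sum_congr rfl h2, ← Finset.mul_sum]
    congr 1
    have h3 : ∀ e ∈ E, ∑ r ∈ e, Φ (r, E) = ∑ r, if r ∈ e then Φ (r, E) else 0 := fun e _ => by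
      rw [Finset.sum_ite_mem]; simp
    rw [Finset.sum_congr rfl h3, Finset.sum_comm]
    refine Finset.sum_congr rfl fun r _ => ?_
    rw [← Finset.sum_filter, Finset.sum_const, nsmul_eq_mul]
    rfl
  · intro a _ b _ hab
    rw [Function.onFun, Finset.disjoint_left]
    intro f hf hf'
    simp only [Finset.mem_filter] at hf hf'
    exact hab (hf.2.2.symm.trans hf'.2.2)

lemma measurable_K : Measurable fun p : (ℝ × ℝ) × (ℝ × ℝ) => K p.1 p.2 := by
  have h : ∀ f g : (ℝ × ℝ) × (ℝ × ℝ) → ℝ, Measurable f → Measurable g →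
      MeasurableSet {p | f p < g p} := fun f g hf hg => measurableSet_lt hf hg
  have h1 : Measurable fun p : (ℝ × ℝ) × (ℝ × ℝ) => p.1.1 := by fun_prop
  have h2 : Measurable fun p : (ℝ × ℝ) × (ℝ × ℝ) => p.1.2 := by fun_prop
  have h3 : Measurable fun p : (ℝ × ℝ) × (ℝ × ℝ) => p.2.1 := by fun_prop
  have h4 : Measurable fun p : (ℝ × ℝ) × (ℝ × ℝ) => p.2.2 := by fun_prop
  unfold K
  exact Measurable.ite
    (((h _ _ h1 h3).inter ((h _ _ h3 h2).inter (h _ _ h2 h4))).union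
      ((h _ _ h3 h1).inter ((h _ _ h1 h4).inter (h _ _ h4 h2))))
    measurable_const measurable_const

lemma measurable_K_comp {α : Type*} [MeasurableSpace α] {f g : α → ℝ × ℝ} (hf : Measurable f)
    (hg : Measurable g) : Measurable fun a => K (f a) (g a) :=
  measurable_K.comp (hf.prodMk hg)

lemma abs_K (x y : ℝ × ℝ) : |K x y| = 1 := by
  unfold K; split_ifs <;> simp

instance : IsProbabilityMeasure nu := by
  unfold nu
  have : IsProbabilityMeasure
      (volume.restrict (Set.Icc (0 : ℝ) 1 ×ˢ Set.Icc (0 : ℝ) 1)) := by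
    constructor
    rw [Measure.restrict_apply_univ, Measure.volume_eq_prod, Measure.prod_prod]
    simp
  exact Measure.isProbabilityMeasure_map (by fun_prop)

lemma ae_mem_Omega : ∀ᵐ x ∂nu, x ∈ Omega := by
  have hO : MeasurableSet Omega := measurableSet_Icc.prod measurableSet_Icc
  unfold nu
  refine (ae_map_iff (p := fun x => x ∈ Omega) (by fun_prop) hO).mpr ?_
  filter_upwards [ae_restrict_mem (measurableSet_Icc.prod measurableSet_Icc)] with p hp
  simp only [Omega, Set.mem_prod, Set.mem_Icc] at hp ⊢
  obtain ⟨⟨h1, h2⟩, h3, h4⟩ := hp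
  exact ⟨⟨le_min h1 h3, (min_le_left _ _).trans h2⟩, ⟨h1.trans (le_max_left _ _), max_le h2 h4⟩⟩

lemma pairSign_mk {n : ℕ} (X : Finset (Fin n) → ℝ × ℝ) (e f : Finset (Fin n)) :
    pairSign X s(e, f) = if Odd (e ∩ f).card then K (X e) (X f) else 1 := rfl

lemma BE_empty {n : ℕ} (X : Finset (Fin n) → ℝ × ℝ) : BE ∅ X = 1 := by simp [BE]

lemma BE_insert {n : ℕ} (X : Finset (Fin n) → ℝ × ℝ) {e : Finset (Fin n)}
    {E : Finset (Finset (Fin n))} (he : e ∉ E) :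
    BE (insert e E) X = (∏ f ∈ E, pairSign X s(e, f)) * BE E X := by
  have h : (insert e E).sym2.filter (fun p => ¬ p.IsDiag) =
      (E.image fun f => s(e, f)) ∪ E.sym2.filter (fun p => ¬ p.IsDiag) := by
    rw [Finset.sym2_insert, Finset.image_insert, Finset.filter_union, Finset.filter_insert]
    simp only [Sym2.mk_isDiag_iff, not_true_eq_false, if_false]
    congr 1
    refine Finset.filter_true_of_mem fun p hp => ?_
    obtain ⟨f, hf, rfl⟩ := Finset.mem_image.mp hp
    rw [Sym2.mk_isDiag_iff]
    rintro rfl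
    exact he hf
  unfold BE
  rw [h, Finset.prod_union, Finset.prod_image]
  · intro a _ b _ hab
    rcases Sym2.eq_iff.mp hab with h | h
    · exact h.2
    · exact h.2.trans h.1
  · rw [Finset.disjoint_left]
    intro p hp hp'
    obtain ⟨f, hf, rfl⟩ := Finset.mem_image.mp hp
    exact he (Finset.mk_mem_sym2_iff.mp (Finset.mem_filter.mp hp').1).1

lemma BE_union {n : ℕ} (X : Finset (Fin n) → ℝ × ℝ) {E F : Finset (Finset (Fin n))}
    (hd : Disjoint E F) (hc : ∀ e ∈ E, ∀ f ∈ F, pairSign X s(e, f) = 1) :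
    BE (E ∪ F) X = BE E X * BE F X := by
  induction E using Finset.induction_on with
  | empty => simp [BE_empty]
  | insert e E he ih =>
    rw [Finset.disjoint_insert_left] at hd
    have he' : e ∉ E ∪ F := by simp [he, hd.1]
    rw [Finset.insert_union, BE_insert X he', BE_insert X he, Finset.prod_union hd.2,
      ih hd.2 fun a ha => hc a (Finset.mem_insert_of_mem ha),
      Finset.prod_eq_one fun f hf => hc e (Finset.mem_insert_self _ _) f hf]
    ring

lemma BE_biUnion {n : ℕ} {ι : Type*} [DecidableEq ι] (X : Finset (Fin n) → ℝ × ℝ)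
    (T : ι → Finset (Finset (Fin n))) (hd : ∀ i j, i ≠ j → Disjoint (T i) (T j))
    (hc : ∀ i j, i ≠ j → ∀ e ∈ T i, ∀ f ∈ T j, pairSign X s(e, f) = 1) (s : Finset ι) :
    BE (s.biUnion T) X = ∏ i ∈ s, BE (T i) X := by
  induction s using Finset.induction_on with
  | empty => simp [BE_empty]
  | insert i s hi ih =>
    have hne : ∀ j ∈ s, i ≠ j := fun j hj h => hi (h ▸ hj)
    rw [Finset.biUnion_insert, BE_union, ih, Finset.prod_insert hi]
    · exact (Finset.disjoint_biUnion_right _ _ _).mpr fun j hj => hd _ _ (hne j hj)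
    · intro e he f hf
      obtain ⟨j, hj, hf⟩ := Finset.mem_biUnion.mp hf
      exact hc i j (hne j hj) e he f hf

lemma BE_congr {n m : ℕ} (j : Finset (Fin m) → Finset (Fin n)) (hj : Function.Injective j)
    (hcard : ∀ e f, (j e ∩ j f).card = (e ∩ f).card) (X : Finset (Fin n) → ℝ × ℝ)
    (Y : Finset (Fin m) → ℝ × ℝ) (E : Finset (Finset (Fin m))) (h : ∀ e ∈ E, X (j e) = Y e) :
    BE (E.image j) X = BE E Y := by
  induction E using Finset.induction_on with
  | empty => simp [BE_empty]
  | insert e E he ih =>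
    have he' : j e ∉ E.image j := by
      simpa [Finset.mem_image, hj.eq_iff] using he
    rw [Finset.image_insert, BE_insert X he', BE_insert Y he, Finset.prod_image hj.injOn,
      ih fun a ha => h a (Finset.mem_insert_of_mem ha)]
    congr 1
    refine Finset.prod_congr rfl fun f hf => ?_
    rw [pairSign_mk, pairSign_mk, hcard, h e (Finset.mem_insert_self _ _),
      h f (Finset.mem_insert_of_mem hf)]

lemma measurable_pairSign {n : ℕ} (p : Sym2 (Finset (Fin n))) :
    Measurable fun X : Finset (Fin n) → ℝ × ℝ => pairSign X p := by
  induction p with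
  | _ e f =>
    simp only [pairSign_mk]
    split_ifs
    · exact measurable_K_comp (measurable_pi_apply e) (measurable_pi_apply f)
    · exact measurable_const

lemma measurable_BE {n : ℕ} (E : Finset (Finset (Fin n))) :
    Measurable fun X : Finset (Fin n) → ℝ × ℝ => BE E X :=
  Finset.measurable_prod _ fun p _ => measurable_pairSign p

lemma abs_BE {n : ℕ} (E : Finset (Finset (Fin n))) (X : Finset (Fin n) → ℝ × ℝ) :
    |BE E X| = 1 := by
  unfold BE
  rw [Finset.abs_prod]
  refine Finset.prod_eq_one fun p _ => ?_
  induction p with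
  | _ e f =>
    rw [pairSign_mk]
    split_ifs
    · exact abs_K _ _
    · simp

/-- The weight of a rooted hypergraph before averaging over the chords, with an external
weight `ψ` attached to the hyperedges at the root. -/
def preWeight {n : ℕ} (ψ : ℝ × ℝ → ℝ) (p : Fin n × Finset (Finset (Fin n)))
    (X : Finset (Fin n) → ℝ × ℝ) : ℝ :=
  (∏ e ∈ p.2.filter fun e => p.1 ∈ e, ψ (X e)) * BE p.2 X

/-- The weight of a rooted hypergraph, averaged over the chords. -/
def rootWeight {n : ℕ} (ψ : ℝ × ℝ → ℝ) (p : Fin n × Finset (Finset (Fin n))) : ℝ :=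
  ∫ X, preWeight ψ p X ∂(Measure.pi fun _ => nu)

lemma rootWeight_one {n : ℕ} (p : Fin n × Finset (Finset (Fin n))) :
    rootWeight (fun _ => 1) p = bT p.2 := by
  simp [rootWeight, preWeight, bT]

lemma abs_preWeight_le {n : ℕ} {ψ : ℝ × ℝ → ℝ} (hψ : ∀ x, |ψ x| ≤ 1)
    (p : Fin n × Finset (Finset (Fin n))) (X : Finset (Fin n) → ℝ × ℝ) :
    |preWeight ψ p X| ≤ 1 := by
  rw [preWeight, abs_mul, abs_BE, mul_one, Finset.abs_prod]
  exact Finset.prod_le_one (fun _ _ => abs_nonneg _) fun _ _ => hψ _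

lemma abs_rootWeight_le {n : ℕ} {ψ : ℝ × ℝ → ℝ} (hψ : ∀ x, |ψ x| ≤ 1)
    (p : Fin n × Finset (Finset (Fin n))) : |rootWeight ψ p| ≤ 1 := by
  have := norm_integral_le_of_norm_le_const (μ := Measure.pi fun _ : Finset (Fin n) => nu)
    (f := preWeight ψ p) (C := 1) (Filter.Eventually.of_forall fun X => abs_preWeight_le hψ p X)
  simpa [rootWeight] using this

lemma measurable_preWeight {α : Type*} [MeasurableSpace α] {n : ℕ} {ψ : α → ℝ × ℝ → ℝ}
    (hψ : Measurable fun x : α × (ℝ × ℝ) => ψ x.1 x.2)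
    (p : Fin n × Finset (Finset (Fin n))) :
    Measurable fun x : α × (Finset (Fin n) → ℝ × ℝ) => preWeight (ψ x.1) p x.2 := by
  refine Measurable.mul (Finset.measurable_prod _ fun e _ => ?_)
    ((measurable_BE p.2).comp measurable_snd)
  exact hψ.comp (measurable_fst.prodMk ((measurable_pi_apply e).comp measurable_snd))

lemma measurable_rootWeight {α : Type*} [MeasurableSpace α] {n : ℕ} {ψ : α → ℝ × ℝ → ℝ}
    (hψ : Measurable fun x : α × (ℝ × ℝ) => ψ x.1 x.2)
    (p : Fin n × Finset (Finset (Fin n))) :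
    Measurable fun a => rootWeight (ψ a) p :=
  (measurable_preWeight hψ p).stronglyMeasurable.integral_prod_right'.measurable

/-- Restricting i.i.d. chords along an injection gives i.i.d. chords. -/
lemma measurePreserving_comp {α β : Type*} [Fintype α] [Fintype β] (j : α → β)
    (hj : Function.Injective j) :
    MeasurePreserving (fun (X : β → ℝ × ℝ) a => X (j a)) (Measure.pi fun _ => nu)
      (Measure.pi fun _ => nu) := by
  refine ⟨by fun_prop, ?_⟩
  symm
  refine Measure.pi_eq fun s hs => ?_
  rw [Measure.map_apply (by fun_prop) (MeasurableSet.univ_pi hs)]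
  have : (fun (X : β → ℝ × ℝ) a => X (j a)) ⁻¹' (Set.univ.pi s) =
      Set.univ.pi fun b => ⋂ a ∈ {a | j a = b}, s a := by
    ext X
    simp only [Set.mem_preimage, Set.mem_pi, Set.mem_univ, true_imp_iff, Set.mem_iInter,
      Set.mem_ofPred_eq]
    constructor
    · rintro h b a rfl
      exact h a
    · intro h a
      exact h (j a) a rfl
  rw [this, Measure.pi_pi, ← Finset.prod_subset (Finset.subset_univ (Finset.univ.image j)),
    Finset.prod_image hj.injOn]
  · refine Finset.prod_congr rfl fun a _ => ?_
    congr 1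
    ext x
    simp [hj.eq_iff]
  · intro b _ hb
    have : (⋂ a ∈ {a | j a = b}, s a) = Set.univ := by
      ext x
      simp only [Set.mem_iInter, Set.mem_ofPred_eq, Set.mem_univ, iff_true]
      rintro a rfl
      exact absurd (Finset.mem_image_of_mem j (Finset.mem_univ a)) hb
    rw [this, measure_univ]

lemma rootWeight_transport {m n : ℕ} (ι : Fin m → Fin n) (hι : Function.Injective ι)
    (ψ : ℝ × ℝ → ℝ) (hψ : Measurable ψ) (p : Fin m × Finset (Finset (Fin m))) :
    rootWeight ψ (ι p.1, p.2.image (Finset.image ι)) = rootWeight ψ p := by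
  have hinj := Finset.image_injective hι
  have hmp := measurePreserving_comp (Finset.image ι) hinj
  have hmeas : Measurable (preWeight ψ p) :=
    (measurable_preWeight (α := Unit) (ψ := fun _ => ψ) (hψ.comp measurable_snd) p).comp
      (measurable_const (a := ()) |>.prodMk measurable_id)
  unfold rootWeight
  rw [← hmp.map_eq, integral_map hmp.measurable.aemeasurable
    hmeas.aestronglyMeasurable]
  refine integral_congr_ae (Filter.Eventually.of_forall fun X => ?_)
  simp only [preWeight]
  rw [BE_congr (Finset.image ι) hinj (fun e f => ?_) X _ p.2 fun _ _ => rfl]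
  · congr 1
    rw [Finset.filter_image, Finset.prod_image hinj.injOn]
    refine Finset.prod_congr ?_ fun _ _ => rfl
    ext e
    simp [hι.eq_iff]
  · rw [← Finset.image_inter _ _ hι, Finset.card_image_of_injective _ hι]

/-- Assemble a chord configuration from one chord and several independent configurations. -/
def glue {q n : ℕ} (e : Finset (Fin n)) (col : Finset (Fin n) → Fin q)
    (x : (ℝ × ℝ) × (Fin q → Finset (Fin n) → ℝ × ℝ)) (g : Finset (Fin n)) : ℝ × ℝ :=
  if g = e then x.1 else x.2 (col g) g

lemma measurable_glue {q n : ℕ} (e : Finset (Fin n)) (col : Finset (Fin n) → Fin q) :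
    Measurable (glue e col) := by
  refine measurable_pi_lambda _ fun g => ?_
  unfold glue
  split_ifs
  · exact measurable_fst
  · exact (measurable_pi_apply g).comp ((measurable_pi_apply (col g)).comp measurable_snd)

lemma measurePreserving_glue {q n : ℕ} (e : Finset (Fin n)) (col : Finset (Fin n) → Fin q) :
    MeasurePreserving (glue e col)
      (nu.prod (Measure.pi fun _ => Measure.pi fun _ => nu)) (Measure.pi fun _ => nu) := by
  refine ⟨measurable_glue e col, ?_⟩
  symm
  refine Measure.pi_eq fun s hs => ?_
  rw [Measure.map_apply (measurable_glue e col) (MeasurableSet.univ_pi hs)]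
  have : glue e col ⁻¹' (Set.univ.pi s) = s e ×ˢ Set.univ.pi fun i => Set.univ.pi fun g =>
      if g ≠ e ∧ col g = i then s g else Set.univ := by
    ext x
    simp only [Set.mem_preimage, Set.mem_pi, Set.mem_univ, true_imp_iff, Set.mem_prod, glue]
    constructor
    · intro h
      refine ⟨by simpa using h e, fun i g => ?_⟩
      split_ifs with h1
      · have := h g
        rw [if_neg h1.1, h1.2] at this
        exact this
      · trivial
    · rintro ⟨h1, h2⟩ g
      split_ifs with hg
      · exact hg ▸ h1
      · have := h2 (col g) g
        rwa [if_pos ⟨hg, rfl⟩] at this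
  rw [this, Measure.prod_prod, Measure.pi_pi]
  simp_rw [Measure.pi_pi]
  rw [Finset.prod_comm, ← Finset.mul_prod_erase Finset.univ (fun g => nu (s g))
    (Finset.mem_univ e), ← Finset.mul_prod_erase Finset.univ _ (Finset.mem_univ e)]
  have h1 : (∏ i, nu (if e ≠ e ∧ col e = i then s e else Set.univ)) = 1 :=
    Finset.prod_eq_one fun i _ => by simp
  rw [h1, one_mul]
  congr 1
  refine Finset.prod_congr rfl fun g hg => ?_
  have hge := Finset.ne_of_mem_erase hg
  rw [Finset.prod_eq_single (col g)]
  · simp [hge]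
  · intro i _ hi
    simp [hi.symm]
  · simp

lemma preWeight_congr {n : ℕ} (ψ : ℝ × ℝ → ℝ) (p : Fin n × Finset (Finset (Fin n)))
    {X Y : Finset (Fin n) → ℝ × ℝ} (h : ∀ e ∈ p.2, X e = Y e) :
    preWeight ψ p X = preWeight ψ p Y := by
  unfold preWeight
  have := BE_congr id Function.injective_id (fun _ _ => rfl) X Y p.2 h
  rw [Finset.image_id] at this
  rw [this]
  congr 1
  exact Finset.prod_congr rfl fun e he => by rw [h e (Finset.mem_filter.mp he).1]

/-- The external weight seen by the `i`-th subtree below a hyperedge with chord `y`. -/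
def chordWeight {k : ℕ} (ψ : ℝ × ℝ → ℝ) (y : ℝ × ℝ) (i : Fin (k + 1)) (x : ℝ × ℝ) : ℝ :=
  (if i = 0 then ψ x else 1) * K y x

lemma abs_chordWeight_le {k : ℕ} {ψ : ℝ × ℝ → ℝ} (hψ : ∀ x, |ψ x| ≤ 1) (y : ℝ × ℝ)
    (i : Fin (k + 1)) (x : ℝ × ℝ) : |chordWeight ψ y i x| ≤ 1 := by
  rw [chordWeight, abs_mul, abs_K, mul_one]
  split_ifs
  · exact hψ x
  · simp

lemma measurable_chordWeight {k : ℕ} {ψ : ℝ × ℝ → ℝ} (hψ : Measurable ψ) (i : Fin (k + 1)) :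
    Measurable fun p : (ℝ × ℝ) × (ℝ × ℝ) => chordWeight ψ p.1 i p.2 := by
  unfold chordWeight
  refine Measurable.mul ?_ measurable_K
  split_ifs
  · exact hψ.comp measurable_snd
  · exact measurable_const

lemma inter_rootEdge {q n : ℕ} {c : Fin n → Fin q} {P : Fin q → Fin n × Finset (Finset (Fin n))}
    (h : IsFamily c P) {i : Fin q} {g : Finset (Fin n)} (hg : g ∈ (P i).2) :
    rootEdge P ∩ g = if (P i).1 ∈ g then {(P i).1} else ∅ := by
  have key : ∀ v ∈ g, (v ∈ rootEdge P ↔ v = (P i).1) := fun v hv => by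
    rw [h.mem_rootEdge, h.color_edge hg hv, eq_comm]
  ext v
  rw [Finset.mem_inter]
  constructor
  · rintro ⟨h1, h2⟩
    have := (key v h2).mp h1
    subst this
    simp [h2]
  · intro hv
    split_ifs at hv with h1
    · rw [Finset.mem_singleton] at hv
      subst hv
      exact ⟨(key _ h1).mpr rfl, h1⟩
    · simp at hv

lemma filter_joinTrees {k n : ℕ} {c : Fin n → Fin (k + 1)}
    {P : Fin (k + 1) → Fin n × Finset (Finset (Fin n))} (h : IsFamily c P) (i : Fin (k + 1)) :
    (joinTrees P).filter (fun e => (P i).1 ∈ e) =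
      insert (rootEdge P) ((P i).2.filter fun e => (P i).1 ∈ e) := by
  rw [joinTrees, Finset.filter_insert, if_pos (by simp [rootEdge])]
  congr 1
  ext g
  simp only [unionTrees, Finset.mem_filter, Finset.mem_biUnion, Finset.mem_univ, true_and]
  constructor
  · rintro ⟨⟨j, hj⟩, hg⟩
    have := h.color_edge hj hg
    rw [h.color_root] at this
    exact ⟨this ▸ hj, hg⟩
  · rintro ⟨h1, h2⟩
    exact ⟨⟨i, h1⟩, h2⟩

lemma rootEdge_notMem_filter {k n : ℕ} (hk : 1 ≤ k) {c : Fin n → Fin (k + 1)}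
    {P : Fin (k + 1) → Fin n × Finset (Finset (Fin n))} (h : IsFamily c P) (i : Fin (k + 1)) :
    rootEdge P ∉ (P i).2.filter fun e => (P i).1 ∈ e := fun hm =>
  h.rootEdge_notMem (by omega)
    (Finset.mem_biUnion.mpr ⟨i, Finset.mem_univ _, (Finset.mem_filter.mp hm).1⟩)

lemma rootDeg_join {k n : ℕ} (hk : 1 ≤ k) {c : Fin n → Fin (k + 1)}
    {P : Fin (k + 1) → Fin n × Finset (Finset (Fin n))} (h : IsFamily c P) :
    rootDeg ((P 0).1, joinTrees P) = rootDeg (P 0) + 1 := by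
  unfold rootDeg
  rw [filter_joinTrees h, Finset.card_insert_of_notMem (rootEdge_notMem_filter hk h 0)]

lemma preWeight_join {k n : ℕ} (hk : 1 ≤ k) {c : Fin n → Fin (k + 1)}
    {P : Fin (k + 1) → Fin n × Finset (Finset (Fin n))} (h : IsFamily c P) (ψ : ℝ × ℝ → ℝ)
    (X : Finset (Fin n) → ℝ × ℝ) :
    preWeight ψ ((P 0).1, joinTrees P) X =
      ψ (X (rootEdge P)) * ∏ i, preWeight (chordWeight ψ (X (rootEdge P)) i) (P i) X := by
  have hsign : ∀ i, ∏ g ∈ (P i).2, pairSign X s(rootEdge P, g) =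
      ∏ g ∈ (P i).2.filter (fun e => (P i).1 ∈ e), K (X (rootEdge P)) (X g) := by
    intro i
    rw [Finset.prod_filter]
    refine Finset.prod_congr rfl fun g hg => ?_
    rw [pairSign_mk, inter_rootEdge h hg]
    by_cases hi : (P i).1 ∈ g <;> simp [hi]
  have hBE : BE (joinTrees P) X =
      ∏ i, ((∏ g ∈ (P i).2.filter (fun e => (P i).1 ∈ e), K (X (rootEdge P)) (X g)) *
        BE (P i).2 X) := by
    rw [joinTrees, BE_insert X (h.rootEdge_notMem (by omega)), unionTrees,
      Finset.prod_biUnion fun i _ j _ hij => h.disjoint (by omega) hij,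
      BE_biUnion X _ fun i j hij => h.disjoint (by omega) hij, ← Finset.prod_mul_distrib]
    · exact Finset.prod_congr rfl fun i _ => by rw [hsign]
    · intro i j hij e he f hf
      have : e ∩ f = ∅ := by
        rw [← Finset.disjoint_iff_inter_eq_empty, Finset.disjoint_left]
        intro v hv hv'
        exact hij ((h.color_edge he hv).symm.trans (h.color_edge hf hv'))
      rw [pairSign_mk, this]
      simp
  have hroot : ∏ e ∈ (joinTrees P).filter (fun e => (P 0).1 ∈ e), ψ (X e) =
      ψ (X (rootEdge P)) * ∏ i, ∏ g ∈ (P i).2.filter (fun e => (P i).1 ∈ e),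
        (if i = 0 then ψ (X g) else 1) := by
    rw [filter_joinTrees h, Finset.prod_insert (rootEdge_notMem_filter hk h 0),
      Fin.prod_univ_succ]
    simp [Fin.succ_ne_zero]
  simp only [preWeight]
  rw [hBE, hroot, mul_assoc, ← Finset.prod_mul_distrib]
  congr 1
  refine Finset.prod_congr rfl fun i _ => ?_
  rw [← mul_assoc, ← Finset.prod_mul_distrib]
  rfl

lemma rootWeight_join {k n : ℕ} (hk : 1 ≤ k) {c : Fin n → Fin (k + 1)}
    {P : Fin (k + 1) → Fin n × Finset (Finset (Fin n))} (h : IsFamily c P) {ψ : ℝ × ℝ → ℝ}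
    (hψ : Measurable ψ) (hψ1 : ∀ x, |ψ x| ≤ 1) :
    rootWeight ψ ((P 0).1, joinTrees P) =
      ∫ y, ψ y * ∏ i, rootWeight (chordWeight ψ y i) (P i) ∂nu := by
  have hcol : ∃ col : Finset (Fin n) → Fin (k + 1), ∀ i, ∀ g ∈ (P i).2, col g = i := by
    refine ⟨fun g => if hg : g.Nonempty then c hg.choose else 0, fun i g hg => ?_⟩
    have hne := h.edge_nonempty (by omega) hg
    simp only [hne, dif_pos]
    exact h.color_edge hg hne.choose_spec
  obtain ⟨col, hcol⟩ := hcol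
  have hmp := measurePreserving_glue (rootEdge P) col
  have hmeas : Measurable (preWeight ψ ((P 0).1, joinTrees P)) :=
    (measurable_preWeight (α := Unit) (ψ := fun _ => ψ) (hψ.comp measurable_snd) _).comp
      (measurable_const (a := ()) |>.prodMk measurable_id)
  have hinteg : Integrable (fun x => preWeight ψ ((P 0).1, joinTrees P) (glue (rootEdge P) col x))
      (nu.prod (Measure.pi fun _ => Measure.pi fun _ => nu)) :=
    Integrable.of_bound (hmeas.comp hmp.measurable).aestronglyMeasurable 1
      (Filter.Eventually.of_forall fun x => abs_preWeight_le hψ1 _ _)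
  unfold rootWeight
  conv_lhs => rw [← hmp.map_eq]
  rw [integral_map hmp.measurable.aemeasurable
    hmeas.aestronglyMeasurable, integral_prod _ hinteg]
  refine integral_congr_ae (Filter.Eventually.of_forall fun y => ?_)
  simp only
  rw [← integral_fintype_prod_eq_prod, ← integral_const_mul]
  refine integral_congr_ae (Filter.Eventually.of_forall fun Y => ?_)
  simp only
  rw [preWeight_join hk h]
  have h0 : glue (rootEdge P) col (y, Y) (rootEdge P) = y := by simp [glue]
  rw [h0]
  congr 1
  refine Finset.prod_congr rfl fun i _ => preWeight_congr _ _ fun g hg => ?_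
  have hne : g ≠ rootEdge P := by
    rintro rfl
    exact h.rootEdge_notMem (by omega) (Finset.mem_biUnion.mpr ⟨i, Finset.mem_univ _, hg⟩)
  simp [glue, hne, hcol i g hg]

lemma treesOn_image {q n m : ℕ} (ι : Fin m → Fin n) (hι : Function.Injective ι)
    {T : Finset (Finset (Fin m))} (hT : T ∈ treesOn q (Finset.univ : Finset (Fin m))) :
    T.image (Finset.image ι) ∈ treesOn q (Finset.univ.image ι) := by
  obtain ⟨h1, h2, h3⟩ := mem_treesOn.mp hT
  refine mem_treesOn.mpr ⟨?_, ?_, ?_⟩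
  · intro e he
    obtain ⟨g, hg, rfl⟩ := Finset.mem_image.mp he
    exact ⟨Finset.image_subset_image (Finset.subset_univ _), by
      rw [Finset.card_image_of_injective _ hι, (h1 g hg).2]⟩
  · intro a ha b hb
    obtain ⟨a, -, rfl⟩ := Finset.mem_image.mp ha
    obtain ⟨b, -, rfl⟩ := Finset.mem_image.mp hb
    refine (h2 a (Finset.mem_univ _) b (Finset.mem_univ _)).lift ι ?_
    rintro a b ⟨g, hg, hag, hbg⟩
    exact ⟨g.image ι, Finset.mem_image_of_mem _ hg, Finset.mem_image_of_mem _ hag,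
      Finset.mem_image_of_mem _ hbg⟩
  · rw [Finset.card_image_of_injective _ (Finset.image_injective hι),
      Finset.card_image_of_injective _ hι]
    exact h3

lemma exists_treesOn_preimage {q n m : ℕ} (ι : Fin m → Fin n) (hι : Function.Injective ι)
    {E : Finset (Finset (Fin n))} (hE : E ∈ treesOn q (Finset.univ.image ι)) :
    ∃ T ∈ treesOn q (Finset.univ : Finset (Fin m)), T.image (Finset.image ι) = E := by
  obtain ⟨h1, h2, h3⟩ := mem_treesOn.mp hE
  set T : Finset (Finset (Fin m)) := Finset.univ.filter fun g => g.image ι ∈ E with hT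
  have himg : T.image (Finset.image ι) = E := by
    ext e
    simp only [hT, Finset.mem_image, Finset.mem_filter, Finset.mem_univ, true_and]
    constructor
    · rintro ⟨g, hg, rfl⟩; exact hg
    · intro he
      obtain ⟨g, -, rfl⟩ := Finset.subset_image_iff.mp (h1 e he).1
      exact ⟨g, he, rfl⟩
  refine ⟨T, mem_treesOn.mpr ⟨?_, ?_, ?_⟩, himg⟩
  · intro g hg
    have := (h1 _ (Finset.mem_filter.mp hg).2).2
    rw [Finset.card_image_of_injective _ hι] at this
    exact ⟨Finset.subset_univ _, this⟩
  · intro a _ b _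
    have h := h2 (ι a) (Finset.mem_image_of_mem _ (Finset.mem_univ _)) (ι b)
      (Finset.mem_image_of_mem _ (Finset.mem_univ _))
    have key : ∀ v, Relation.ReflTransGen (edgeRel E) (ι a) v →
        ∃ w, ι w = v ∧ Relation.ReflTransGen (edgeRel T) a w := by
      intro v hv
      induction hv with
      | refl => exact ⟨a, rfl, Relation.ReflTransGen.refl⟩
      | tail _ hbc ih =>
        obtain ⟨w, rfl, hw⟩ := ih
        obtain ⟨e, he, hb, hc⟩ := hbc
        rw [← himg] at he
        obtain ⟨g, hg, rfl⟩ := Finset.mem_image.mp he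
        obtain ⟨u, hu, rfl⟩ := Finset.mem_image.mp hc
        obtain ⟨w', hw', hww⟩ := Finset.mem_image.mp hb
        rw [hι hww] at hw'
        exact ⟨u, rfl, hw.tail ⟨g, hg, hw', hu⟩⟩
    obtain ⟨w, hw, h'⟩ := key _ h
    rw [← hι hw]
    exact h'
  · rw [← himg, Finset.card_image_of_injective _ (Finset.image_injective hι),
      Finset.card_image_of_injective _ hι] at h3
    exact h3

lemma sum_rootedOn_transport {q n : ℕ} (A : Finset (Fin n))
    (F : Fin n × Finset (Finset (Fin n)) → ℝ)
    (G : Fin A.card × Finset (Finset (Fin A.card)) → ℝ)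
    (h : ∀ p, F (A.orderEmbOfFin rfl p.1, p.2.image (Finset.image (A.orderEmbOfFin rfl))) = G p) :
    ∑ p ∈ rootedOn q A, F p = ∑ p ∈ rootedOn q (Finset.univ : Finset (Fin A.card)), G p := by
  have himg : Finset.univ.image (A.orderEmbOfFin rfl) = A := Finset.image_orderEmbOfFin_univ A rfl
  have hinj : Function.Injective (A.orderEmbOfFin rfl) := (A.orderEmbOfFin rfl).injective
  symm
  refine Finset.sum_nbij
    (fun p => (A.orderEmbOfFin rfl p.1, p.2.image (Finset.image (A.orderEmbOfFin rfl))))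
    ?_ ?_ ?_ fun p _ => (h p).symm
  · intro p hp
    have := treesOn_image _ hinj (mem_rootedOn.mp hp).2
    rw [himg] at this
    exact mem_rootedOn.mpr ⟨Finset.orderEmbOfFin_mem _ _ _, this⟩
  · rintro p - p' - heq
    simp only [Prod.mk.injEq] at heq
    exact Prod.ext (hinj heq.1) (Finset.image_injective (Finset.image_injective hinj) heq.2)
  · rintro ⟨r, E⟩ hp
    obtain ⟨h1, h2⟩ := mem_rootedOn.mp (Finset.mem_coe.mp hp)
    rw [← himg] at h1 h2
    obtain ⟨s, -, hs⟩ := Finset.mem_image.mp h1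
    obtain ⟨T, hT, hTE⟩ := exists_treesOn_preimage _ hinj h2
    exact ⟨(s, T), Finset.mem_coe.mpr (mem_rootedOn.mpr ⟨Finset.mem_univ _, hT⟩),
      Prod.ext hs hTE⟩

lemma rootDeg_transport {m n : ℕ} (ι : Fin m → Fin n) (hι : Function.Injective ι)
    (p : Fin m × Finset (Finset (Fin m))) :
    rootDeg (ι p.1, p.2.image (Finset.image ι)) = rootDeg p := by
  unfold rootDeg
  rw [Finset.filter_image, Finset.card_image_of_injective _ (Finset.image_injective hι)]
  congr 1
  ext e
  simp [hι.eq_iff]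

/-- The total weight of rooted hypertrees on `n` labelled vertices; the root degree `d` carries
the extra factor `χ d`. -/
def treeWeight (q n : ℕ) (χ : ℕ → ℝ) (ψ : ℝ × ℝ → ℝ) : ℝ :=
  ∑ p ∈ rootedOn q (Finset.univ : Finset (Fin n)), χ (rootDeg p) * rootWeight ψ p

/-- The number of rooted hypertrees on `n` labelled vertices, counted with the factor `χ d`
for root degree `d`. -/
def treeCount (q n : ℕ) (χ : ℕ → ℝ) : ℝ :=
  ∑ p ∈ rootedOn q (Finset.univ : Finset (Fin n)), χ (rootDeg p)

lemma sum_treeWeight {q n : ℕ} (A : Finset (Fin n)) (χ : ℕ → ℝ) {ψ : ℝ × ℝ → ℝ}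
    (hψ : Measurable ψ) :
    ∑ p ∈ rootedOn q A, χ (rootDeg p) * rootWeight ψ p = treeWeight q A.card χ ψ :=
  sum_rootedOn_transport A _ _ fun p => by
    rw [rootDeg_transport _ (A.orderEmbOfFin rfl).injective,
      rootWeight_transport _ (A.orderEmbOfFin rfl).injective _ hψ]

lemma sum_treeCount {q n : ℕ} (A : Finset (Fin n)) (χ : ℕ → ℝ) :
    ∑ p ∈ rootedOn q A, χ (rootDeg p) = treeCount q A.card χ :=
  sum_rootedOn_transport A _ _ fun p => by
    rw [rootDeg_transport _ (A.orderEmbOfFin rfl).injective]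

/-- The degree factor of the `i`-th subtree after removing one hyperedge at the root. -/
def shiftDeg {k : ℕ} (χ : ℕ → ℝ) (i : Fin (k + 1)) (d : ℕ) : ℝ :=
  if i = 0 then χ (d + 1) else 1

lemma prod_shiftDeg {k : ℕ} (χ : ℕ → ℝ) (d : Fin (k + 1) → ℕ) :
    ∏ i, shiftDeg χ i (d i) = χ (d 0 + 1) := by
  simp [shiftDeg]

lemma isFamily_iff {q n : ℕ} {c : Fin n → Fin q}
    {P : Fin q → Fin n × Finset (Finset (Fin n))} :
    P ∈ Fintype.piFinset (fun i => rootedOn q (fib c i)) ↔ IsFamily c P :=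
  Fintype.mem_piFinset

lemma treeCount_rec (k n : ℕ) (hk : 1 ≤ k) (χ : ℕ → ℝ) :
    (k.factorial : ℝ) * treeCount (k + 1) n (fun d => d * χ d) =
      ∑ c : Fin n → Fin (k + 1), ∏ i, treeCount (k + 1) (fib c i).card (shiftDeg χ i) := by
  unfold treeCount
  rw [sum_rootDeg k hk fun p => χ (rootDeg p)]
  refine Finset.sum_congr rfl fun c _ => ?_
  have : ∀ i, ∑ p ∈ rootedOn (k + 1) (Finset.univ : Finset (Fin (fib c i).card)),
      shiftDeg χ i (rootDeg p) = ∑ p ∈ rootedOn (k + 1) (fib c i), shiftDeg χ i (rootDeg p) :=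
    fun i => (sum_treeCount (fib c i) (shiftDeg χ i)).symm
  simp_rw [this]
  rw [Finset.prod_univ_sum]
  refine Finset.sum_congr rfl fun P hP => ?_
  rw [rootDeg_join hk (isFamily_iff.mp hP), prod_shiftDeg χ fun i => rootDeg (P i)]

lemma integrable_rootWeight_prod {k : ℕ} {n : Fin (k + 1) → ℕ} {ψ : ℝ × ℝ → ℝ}
    (hψ : Measurable ψ) (hψ1 : ∀ x, |ψ x| ≤ 1)
    (P : ∀ i, Fin (n i) × Finset (Finset (Fin (n i)))) :
    Integrable (fun y => ψ y * ∏ i, rootWeight (chordWeight ψ y i) (P i)) nu := by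
  refine Integrable.of_bound (Measurable.aestronglyMeasurable (hψ.mul
    (Finset.measurable_prod _ fun i _ =>
      measurable_rootWeight (measurable_chordWeight hψ i) (P i)))) 1
    (Filter.Eventually.of_forall fun y => ?_)
  rw [norm_mul, norm_prod]
  exact mul_le_one₀ (hψ1 y) (Finset.prod_nonneg fun _ _ => norm_nonneg _)
    (Finset.prod_le_one (fun _ _ => norm_nonneg _) fun i _ =>
      abs_rootWeight_le (abs_chordWeight_le hψ1 y i) _)

lemma treeWeight_rec (k n : ℕ) (hk : 1 ≤ k) (χ : ℕ → ℝ) {ψ : ℝ × ℝ → ℝ} (hψ : Measurable ψ)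
    (hψ1 : ∀ x, |ψ x| ≤ 1) :
    (k.factorial : ℝ) * treeWeight (k + 1) n (fun d => d * χ d) ψ =
      ∫ y, ψ y * ∑ c : Fin n → Fin (k + 1),
        ∏ i, treeWeight (k + 1) (fib c i).card (shiftDeg χ i) (chordWeight ψ y i) ∂nu := by
  have h1 : ∀ y, ψ y * ∑ c : Fin n → Fin (k + 1),
      ∏ i, treeWeight (k + 1) (fib c i).card (shiftDeg χ i) (chordWeight ψ y i) =
      ∑ c : Fin n → Fin (k + 1), ∑ P ∈ Fintype.piFinset fun i => rootedOn (k + 1) (fib c i),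
        χ (rootDeg (P 0) + 1) * (ψ y * ∏ i, rootWeight (chordWeight ψ y i) (P i)) := by
    intro y
    rw [Finset.mul_sum]
    refine Finset.sum_congr rfl fun c _ => ?_
    have : ∀ i, treeWeight (k + 1) (fib c i).card (shiftDeg χ i) (chordWeight ψ y i) =
        ∑ p ∈ rootedOn (k + 1) (fib c i), shiftDeg χ i (rootDeg p) *
          rootWeight (chordWeight ψ y i) p := fun i =>
      (sum_treeWeight (fib c i) (shiftDeg χ i)
        ((measurable_chordWeight hψ i).comp (measurable_const.prodMk measurable_id))).symm
    simp_rw [this]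
    rw [Finset.prod_univ_sum, Finset.mul_sum]
    refine Finset.sum_congr rfl fun P _ => ?_
    rw [Finset.prod_mul_distrib, prod_shiftDeg χ fun i => rootDeg (P i)]
    ring
  simp_rw [h1]
  rw [integral_finsetSum _ fun c _ => integrable_finsetSum _ fun P _ =>
    (integrable_rootWeight_prod hψ hψ1 P).const_mul _]
  unfold treeWeight
  have h2 := sum_rootDeg (n := n) k hk fun p => χ (rootDeg p) * rootWeight ψ p
  simp only [← mul_assoc] at h2
  rw [h2]
  refine Finset.sum_congr rfl fun c _ => ?_
  rw [integral_finsetSum _ fun P _ => (integrable_rootWeight_prod hψ hψ1 P).const_mul _]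
  refine Finset.sum_congr rfl fun P hP => ?_
  rw [integral_const_mul, rootWeight_join hk (isFamily_iff.mp hP) hψ hψ1,
    rootDeg_join hk (isFamily_iff.mp hP)]

lemma tsum_coeff_prod {𝕜 : Type*} [RCLike 𝕜] {ι : Type*} [DecidableEq ι]
    (f : ι → PowerSeries 𝕜) (z : 𝕜)
    (h : ∀ i, Summable fun n => ‖PowerSeries.coeff n (f i) * z ^ n‖) (s : Finset ι) :
    (Summable fun n => ‖PowerSeries.coeff n (∏ i ∈ s, f i) * z ^ n‖) ∧
      ∑' n, PowerSeries.coeff n (∏ i ∈ s, f i) * z ^ n =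
        ∏ i ∈ s, ∑' n, PowerSeries.coeff n (f i) * z ^ n := by
  induction s using Finset.induction_on with
  | empty =>
    have hne : ∀ n ∉ ({0} : Finset ℕ),
        PowerSeries.coeff n (1 : PowerSeries 𝕜) * z ^ n = 0 := fun n hn => by
      rw [PowerSeries.coeff_one, if_neg (by simpa using hn), zero_mul]
    simp only [Finset.prod_empty]
    refine ⟨summable_of_ne_finset_zero (s := {0}) fun n hn => by rw [hne n hn, norm_zero], ?_⟩
    rw [tsum_eq_sum hne]
    simp
  | insert i s hi ih =>
    have key : ∀ n, PowerSeries.coeff n (∏ j ∈ insert i s, f j) * z ^ n =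
        ∑ p ∈ Finset.HasAntidiagonal.antidiagonal n, (PowerSeries.coeff p.1 (f i) * z ^ p.1) *
          (PowerSeries.coeff p.2 (∏ j ∈ s, f j) * z ^ p.2) := by
      intro n
      rw [Finset.prod_insert hi, PowerSeries.coeff_mul, Finset.sum_mul]
      refine Finset.sum_congr rfl fun p hp => ?_
      have hp' : p.1 + p.2 = n := Finset.HasAntidiagonal.mem_antidiagonal.mp hp
      rw [← hp', pow_add]
      ring
    have h1 := summable_norm_sum_mul_antidiagonal_of_summable_norm
      (f := fun n => PowerSeries.coeff n (f i) * z ^ n)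
      (g := fun n => PowerSeries.coeff n (∏ j ∈ s, f j) * z ^ n) (h i) ih.1
    have h2 := tsum_mul_tsum_eq_tsum_sum_antidiagonal_of_summable_norm
      (f := fun n => PowerSeries.coeff n (f i) * z ^ n)
      (g := fun n => PowerSeries.coeff n (∏ j ∈ s, f j) * z ^ n) (h i) ih.1
    rw [funext key, Finset.prod_insert hi (f := fun i => ∑' n, PowerSeries.coeff n (f i) * z ^ n),
      ← ih.2, h2]
    exact ⟨by simpa only [key] using h1, rfl⟩

lemma derivative_prod {𝕜 : Type*} [RCLike 𝕜] {ι : Type*} [DecidableEq ι]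
    (f : ι → PowerSeries 𝕜) (s : Finset ι) :
    PowerSeries.derivative 𝕜 (∏ i ∈ s, f i) =
      ∑ i ∈ s, ∏ j ∈ s, Function.update f i (PowerSeries.derivative 𝕜 (f i)) j := by
  induction s using Finset.induction_on with
  | empty => simp
  | insert i s hi ih =>
    rw [Finset.prod_insert hi, Derivation.leibniz, ih, Finset.sum_insert hi,
      Finset.prod_insert hi]
    simp only [smul_eq_mul, Function.update_self]
    rw [add_comm, Finset.mul_sum, mul_comm]
    have hne : ∀ j ∈ s, j ≠ i := fun j hj h => hi (h ▸ hj)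
    congr 1
    · refine congrArg₂ _ rfl (Finset.prod_congr rfl fun j hj => ?_)
      rw [Function.update_of_ne (hne j hj)]
    · refine Finset.sum_congr rfl fun j hj => ?_
      rw [Finset.prod_insert hi, Function.update_of_ne (hne j hj).symm]

lemma card_fib_cons {ι : Type*} [DecidableEq ι] {n : ℕ} (i : ι) (c : Fin n → ι) (j : ι) :
    (fib (Fin.cons i c : Fin (n + 1) → ι) j).card = (fib c j).card + if j = i then 1 else 0 := by
  simp only [fib, Finset.card_filter, Fin.sum_univ_succ, Fin.cons_zero, Fin.cons_succ]
  rw [add_comm]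
  simp [eq_comm]

section GeneratingFunctions

variable {𝕜 : Type*} [RCLike 𝕜] {ι : Type*} [Fintype ι] [DecidableEq ι]

/-- The formal exponential generating function. -/
def egf (a : ℕ → 𝕜) : PowerSeries 𝕜 := PowerSeries.mk fun n => a n / (n.factorial : 𝕜)

lemma derivative_egf (a : ℕ → 𝕜) :
    PowerSeries.derivative 𝕜 (egf a) = egf fun n => a (n + 1) := by
  ext n
  rw [PowerSeries.coeff_derivative, egf, egf, PowerSeries.coeff_mk, PowerSeries.coeff_mk,
    Nat.factorial_succ]
  have h1 : (n.factorial : 𝕜) ≠ 0 := Nat.cast_ne_zero.mpr n.factorial_ne_zero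
  have h2 : ((n : 𝕜) + 1) ≠ 0 := Nat.cast_add_one_ne_zero n
  push_cast
  field_simp

/-- Products of exponential generating functions count coloured structures. -/
lemma coeff_prod_egf (n : ℕ) : ∀ a : ι → ℕ → 𝕜,
    (n.factorial : 𝕜) * PowerSeries.coeff n (∏ i, egf (a i)) =
      ∑ c : Fin n → ι, ∏ i, a i (fib c i).card := by
  induction n with
  | zero =>
    intro a
    simp [egf, fib, map_prod]
  | succ n ih =>
    intro a
    have h1 : ((n + 1).factorial : 𝕜) * PowerSeries.coeff (n + 1) (∏ i, egf (a i)) =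
        (n.factorial : 𝕜) * PowerSeries.coeff n (PowerSeries.derivative 𝕜 (∏ i, egf (a i))) := by
      rw [PowerSeries.coeff_derivative, Nat.factorial_succ]
      push_cast
      ring
    have h2 : ∀ i, ∏ j, Function.update (fun i => egf (a i)) i
        (PowerSeries.derivative 𝕜 (egf (a i))) j =
        ∏ j, egf (Function.update a i (fun m => a i (m + 1)) j) := by
      intro i
      refine Finset.prod_congr rfl fun j _ => ?_
      by_cases hj : j = i
      · subst hj
        simp [derivative_egf]
      · simp [hj]
    rw [h1, derivative_prod, map_sum, Finset.mul_sum,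
      ← Equiv.sum_comp (Fin.consEquiv fun _ : Fin (n + 1) => ι), Fintype.sum_prod_type]
    refine Finset.sum_congr rfl fun i _ => ?_
    rw [h2, ih]
    refine Finset.sum_congr rfl fun c _ => Finset.prod_congr rfl fun j _ => ?_
    have : (Fin.consEquiv fun _ : Fin (n + 1) => ι) (i, c) = (Fin.cons i c : Fin (n + 1) → ι) :=
      rfl
    rw [this, card_fib_cons]
    by_cases hj : j = i
    · subst hj
      simp
    · simp [hj]

lemma coeff_egf_mul (a : ℕ → 𝕜) (z : 𝕜) (n : ℕ) :
    PowerSeries.coeff n (egf a) * z ^ n = z ^ n / (n.factorial : 𝕜) * a n := by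
  rw [egf, PowerSeries.coeff_mk]; ring

/-- The product formula for convergent exponential generating functions. -/
lemma tsum_coloured (a : ι → ℕ → 𝕜) (z : 𝕜)
    (h : ∀ i, Summable fun n => ‖z ^ n / (n.factorial : 𝕜) * a i n‖) :
    (Summable fun n => ‖z ^ n / (n.factorial : 𝕜) *
      ∑ c : Fin n → ι, ∏ i, a i (fib c i).card‖) ∧
      ∑' n, z ^ n / (n.factorial : 𝕜) * ∑ c : Fin n → ι, ∏ i, a i (fib c i).card =
        ∏ i, ∑' n, z ^ n / (n.factorial : 𝕜) * a i n := by
  have key : ∀ n, z ^ n / (n.factorial : 𝕜) * ∑ c : Fin n → ι, ∏ i, a i (fib c i).card =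
      PowerSeries.coeff n (∏ i, egf (a i)) * z ^ n := by
    intro n
    have h1 : (n.factorial : 𝕜) ≠ 0 := Nat.cast_ne_zero.mpr n.factorial_ne_zero
    rw [← coeff_prod_egf]
    field_simp
  simp only [key]
  have := tsum_coeff_prod (fun i => egf (a i)) z (fun i => by simpa only [coeff_egf_mul] using h i)
    Finset.univ
  simpa only [coeff_egf_mul] using this

end GeneratingFunctions

/-- The indicator of a root degree. -/
def degInd (d m : ℕ) : ℝ := if m = d then 1 else 0

lemma degInd_nonneg (d m : ℕ) : 0 ≤ degInd d m := by unfold degInd; split_ifs <;> simp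

lemma degInd_le_one (d m : ℕ) : degInd d m ≤ 1 := by unfold degInd; split_ifs <;> simp

lemma hasSum_degInd (m : ℕ) : HasSum (fun d => degInd d m) 1 := by
  unfold degInd
  simpa only [eq_comm] using hasSum_ite_eq m (1 : ℝ)

lemma mul_degInd (d m : ℕ) : (m : ℝ) * degInd d m = d * degInd d m := by
  unfold degInd
  split_ifs with h
  · rw [h]
  · simp

lemma shiftDeg_degInd_zero {k : ℕ} (d : ℕ) :
    shiftDeg (k := k) (degInd (d + 1)) 0 = degInd d := by
  funext m
  simp [shiftDeg, degInd]

lemma shiftDeg_of_ne {k : ℕ} (χ : ℕ → ℝ) {i : Fin (k + 1)} (hi : i ≠ 0) :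
    shiftDeg χ i = fun _ => 1 := by
  funext m
  simp [shiftDeg, hi]

lemma shiftDeg_nonneg {k : ℕ} {χ : ℕ → ℝ} (h : ∀ d, 0 ≤ χ d) (i : Fin (k + 1)) (d : ℕ) :
    0 ≤ shiftDeg χ i d := by
  unfold shiftDeg
  split_ifs
  · exact h _
  · exact zero_le_one

lemma shiftDeg_le_one {k : ℕ} {χ : ℕ → ℝ} (h : ∀ d, χ d ≤ 1) (i : Fin (k + 1)) (d : ℕ) :
    shiftDeg χ i d ≤ 1 := by
  unfold shiftDeg
  split_ifs
  · exact h _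
  · exact le_rfl

lemma treeCount_zero (q : ℕ) (χ : ℕ → ℝ) : treeCount q 0 χ = 0 :=
  Finset.sum_eq_zero fun p _ => p.1.elim0

lemma treeCount_nonneg (q n : ℕ) {χ : ℕ → ℝ} (h : ∀ d, 0 ≤ χ d) : 0 ≤ treeCount q n χ :=
  Finset.sum_nonneg fun _ _ => h _

lemma treeCount_le_one (q n : ℕ) {χ : ℕ → ℝ} (h : ∀ d, χ d ≤ 1) :
    treeCount q n χ ≤ treeCount q n fun _ => 1 :=
  Finset.sum_le_sum fun _ _ => h _

lemma hasSum_treeCount (q n : ℕ) :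
    HasSum (fun d => treeCount q n (degInd d)) (treeCount q n fun _ => 1) :=
  hasSum_sum fun _ _ => hasSum_degInd _

lemma hasSum_treeWeight (q n : ℕ) (ψ : ℝ × ℝ → ℝ) :
    HasSum (fun d => treeWeight q n (degInd d) ψ) (treeWeight q n (fun _ => 1) ψ) :=
  hasSum_sum fun _ _ => (hasSum_degInd _).mul_right _

lemma abs_treeWeight_le (q n : ℕ) {χ : ℕ → ℝ} (h : ∀ d, 0 ≤ χ d) {ψ : ℝ × ℝ → ℝ}
    (hψ : ∀ x, |ψ x| ≤ 1) : |treeWeight q n χ ψ| ≤ treeCount q n χ := by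
  refine (Finset.abs_sum_le_sum_abs _ _).trans (Finset.sum_le_sum fun p _ => ?_)
  rw [abs_mul, abs_of_nonneg (h _)]
  exact mul_le_of_le_one_right (h _) (abs_rootWeight_le hψ p)

lemma measurable_treeWeight {α : Type*} [MeasurableSpace α] (q n : ℕ) (χ : ℕ → ℝ)
    {ψ : α → ℝ × ℝ → ℝ} (hψ : Measurable fun x : α × (ℝ × ℝ) => ψ x.1 x.2) :
    Measurable fun a => treeWeight q n χ (ψ a) :=
  Finset.measurable_sum _ fun p _ => (measurable_rootWeight hψ p).const_mul _

/-- A rooted hypertree with no hyperedge at the root is a single vertex. -/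
lemma eq_of_rootDeg_zero {q n : ℕ} (hq : 2 ≤ q) {p : Fin n × Finset (Finset (Fin n))}
    (hp : p ∈ rootedOn q (Finset.univ : Finset (Fin n))) (h0 : rootDeg p = 0) :
    n = 1 ∧ p.2 = ∅ := by
  obtain ⟨-, hc, hcard⟩ := mem_treesOn.mp (mem_rootedOn.mp hp).2
  have hall : ∀ b, b = p.1 := fun b => by
    rcases Relation.ReflTransGen.cases_head (hc p.1 (Finset.mem_univ _) b (Finset.mem_univ _)) with
      h | ⟨c, ⟨e, he, h1, -⟩, -⟩
    · exact h.symm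
    · exact absurd (Finset.mem_filter.mpr ⟨he, h1⟩)
        (by rw [Finset.card_eq_zero.mp h0]; exact Finset.notMem_empty _)
  have hn : n = 1 := by
    have : Finset.univ = {p.1} := Finset.eq_singleton_iff_unique_mem.mpr
      ⟨Finset.mem_univ _, fun b _ => hall b⟩
    simpa using congrArg Finset.card this
  refine ⟨hn, Finset.card_eq_zero.mp ?_⟩
  rw [Finset.card_univ, Fintype.card_fin] at hcard
  have h1 : (q - 1) * p.2.card = 0 := by omega
  rcases Nat.mul_eq_zero.mp h1 with h | h
  · omega
  · exact h

lemma sum_rootDeg_zero {q : ℕ} (hq : 2 ≤ q) (n : ℕ)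
    (F : ∀ n, Fin n × Finset (Finset (Fin n)) → ℝ) (hF : F 1 (0, ∅) = 1) :
    ∑ p ∈ rootedOn q (Finset.univ : Finset (Fin n)), degInd 0 (rootDeg p) * F n p =
      if n = 1 then 1 else 0 := by
  split_ifs with hn
  · subst hn
    rw [Finset.sum_eq_single (0, ∅)]
    · simp [rootDeg, degInd, hF]
    · intro p hp hne
      have : rootDeg p ≠ 0 := fun h0 => hne
        (Prod.ext (Subsingleton.elim _ _) (eq_of_rootDeg_zero hq hp h0).2)
      simp [degInd, this]
    · intro h
      refine absurd (mem_rootedOn.mpr ⟨Finset.mem_univ _, mem_treesOn.mpr ⟨by simp, ?_, by simp⟩⟩) h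
      intro a _ b _
      rw [Subsingleton.elim a b]
  · refine Finset.sum_eq_zero fun p hp => ?_
    have : rootDeg p ≠ 0 := fun h0 => hn (eq_of_rootDeg_zero hq hp h0).1
    simp [degInd, this]

lemma treeCount_degInd_zero {q : ℕ} (hq : 2 ≤ q) (n : ℕ) :
    treeCount q n (degInd 0) = if n = 1 then 1 else 0 := by
  have := sum_rootDeg_zero hq n (fun _ _ => 1) rfl
  simpa [treeCount] using this

lemma treeWeight_degInd_zero {q : ℕ} (hq : 2 ≤ q) (n : ℕ) (ψ : ℝ × ℝ → ℝ) :
    treeWeight q n (degInd 0) ψ = if n = 1 then 1 else 0 :=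
  sum_rootDeg_zero hq n (fun _ p => rootWeight ψ p) (by simp [rootWeight, preWeight, BE_empty])

/-- Partial sums of the generating function of rooted hypertrees at `e⁻²`. -/
def countSum (q N : ℕ) (χ : ℕ → ℝ) : ℝ :=
  ∑ n ∈ Finset.range (N + 1), Real.exp (-2) ^ n / (n.factorial : ℝ) * treeCount q n χ

lemma countSum_nonneg (q N : ℕ) {χ : ℕ → ℝ} (h : ∀ d, 0 ≤ χ d) : 0 ≤ countSum q N χ :=
  Finset.sum_nonneg fun n _ => mul_nonneg (by positivity) (treeCount_nonneg q n h)

lemma card_fib_lt {k n : ℕ} (hk : 1 ≤ k) (c : Fin n → Fin (k + 1)) (h : ∀ i, (fib c i).card ≠ 0)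
    (i : Fin (k + 1)) : (fib c i).card < n := by
  have : Nontrivial (Fin (k + 1)) := Fin.nontrivial_iff_two_le.mpr (by omega)
  obtain ⟨j, hj⟩ := exists_ne i
  obtain ⟨x, hx⟩ := Finset.card_pos.mp (Nat.pos_of_ne_zero (h j))
  have := Finset.card_lt_univ_of_notMem (s := fib c i) (x := x)
    fun hi => hj (by rw [← mem_fib.mp hx, ← mem_fib.mp hi])
  simpa using this

lemma countSum_rec (k N : ℕ) (hk : 1 ≤ k) {χ : ℕ → ℝ} (hχ : ∀ d, 0 ≤ χ d) :
    (k.factorial : ℝ) * countSum (k + 1) (N + 1) (fun d => d * χ d) ≤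
      ∏ i : Fin (k + 1), countSum (k + 1) N (shiftDeg χ i) := by
  set a : Fin (k + 1) → ℕ → ℝ :=
    fun i n => if n ≤ N then treeCount (k + 1) n (shiftDeg χ i) else 0 with ha
  have ha0 : ∀ i n, 0 ≤ a i n := fun i n => by
    simp only [ha]
    split_ifs
    · exact treeCount_nonneg _ _ (shiftDeg_nonneg hχ i)
    · exact le_rfl
  have hzero : ∀ i, ∀ n ∉ Finset.range (N + 1),
      Real.exp (-2) ^ n / (n.factorial : ℝ) * a i n = 0 := fun i n hn => by
    have : ¬ n ≤ N := by simpa [Nat.lt_succ_iff] using hn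
    simp [ha, this]
  have hsum : ∀ i, ∑' n, Real.exp (-2) ^ n / (n.factorial : ℝ) * a i n =
      countSum (k + 1) N (shiftDeg χ i) := fun i => by
    rw [tsum_eq_sum (hzero i)]
    refine Finset.sum_congr rfl fun n hn => ?_
    have : n ≤ N := Nat.lt_succ_iff.mp (Finset.mem_range.mp hn)
    simp [ha, this]
  obtain ⟨h1, h2⟩ := tsum_coloured a (Real.exp (-2)) fun i =>
    summable_of_ne_finset_zero (s := Finset.range (N + 1)) fun n hn => by
      rw [hzero i n hn, norm_zero]
  have hterm : ∀ n ∈ Finset.range (N + 1 + 1),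
      (k.factorial : ℝ) * (Real.exp (-2) ^ n / (n.factorial : ℝ) *
        treeCount (k + 1) n fun d => d * χ d) =
      Real.exp (-2) ^ n / (n.factorial : ℝ) *
        ∑ c : Fin n → Fin (k + 1), ∏ i, a i (fib c i).card := fun n hn => by
    rw [mul_left_comm, treeCount_rec k n hk]
    congr 1
    refine Finset.sum_congr rfl fun c _ => ?_
    by_cases hc : ∀ i, (fib c i).card ≠ 0
    · refine Finset.prod_congr rfl fun i _ => ?_
      have := card_fib_lt hk c hc i
      have hn' := Finset.mem_range.mp hn
      have hle : (fib c i).card ≤ N := by omega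
      simp only [ha, if_pos hle]
    · push Not at hc
      obtain ⟨i, hi⟩ := hc
      rw [Finset.prod_eq_zero (Finset.mem_univ i) (by rw [hi, treeCount_zero]),
        Finset.prod_eq_zero (Finset.mem_univ i) (by simp [ha, hi, treeCount_zero])]
  rw [countSum, Finset.mul_sum, Finset.sum_congr rfl hterm, ← Finset.prod_congr rfl fun i _ => hsum i,
    ← h2]
  refine Summable.sum_le_tsum _ (fun n _ => ?_) (Summable.of_norm h1)
  exact mul_nonneg (by positivity)
    (Finset.sum_nonneg fun c _ => Finset.prod_nonneg fun i _ => ha0 i _)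

lemma hasSum_countSum (q N : ℕ) :
    HasSum (fun d => countSum q N (degInd d)) (countSum q N fun _ => 1) :=
  hasSum_sum fun n _ => (hasSum_treeCount q n).mul_left _

lemma countSum_le_one_of {q N : ℕ}
    (h : ∀ d, countSum q N (degInd d) ≤ Real.exp (-2) / (d.factorial : ℝ)) :
    countSum q N (fun _ => 1) ≤ 1 := by
  have h1 : HasSum (fun d : ℕ => Real.exp (-2) * ((1 : ℝ) ^ d / (d.factorial : ℝ)))
      (Real.exp (-2) * Real.exp 1) := by
    have := NormedSpace.expSeries_div_hasSum_exp (𝔸 := ℝ) (1 : ℝ)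
    rw [← Real.exp_eq_exp_ℝ] at this
    exact this.mul_left _
  refine (hasSum_le (fun d => (h d).trans_eq (by ring)) (hasSum_countSum q N) h1).trans ?_
  rw [← Real.exp_add]
  exact Real.exp_le_one_iff.mpr (by norm_num)

lemma countSum_degInd_le (k : ℕ) (hk : 1 ≤ k) (N : ℕ) : ∀ d,
    countSum (k + 1) N (degInd d) ≤ Real.exp (-2) / (d.factorial : ℝ) := by
  have hbase : ∀ N, countSum (k + 1) N (degInd 0) ≤ Real.exp (-2) := fun N => by
    unfold countSum
    simp only [treeCount_degInd_zero (show 2 ≤ k + 1 by omega)]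
    simp only [mul_ite, mul_one, mul_zero, Finset.sum_ite_eq']
    split_ifs
    · simp
    · positivity
  induction N with
  | zero =>
    intro d
    simp only [countSum, zero_add, Finset.range_one, Finset.sum_singleton, treeCount_zero,
      mul_zero]
    positivity
  | succ N ih =>
    intro d
    cases d with
    | zero => simpa using hbase (N + 1)
    | succ d =>
      have h1 := countSum_rec k N hk (degInd_nonneg (d + 1))
      have h2 : countSum (k + 1) (N + 1) (fun m => m * degInd (d + 1) m) =
          (d + 1) * countSum (k + 1) (N + 1) (degInd (d + 1)) := by
        simp only [countSum, treeCount, mul_degInd, Finset.mul_sum]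
        push_cast
        exact Finset.sum_congr rfl fun _ _ => Finset.sum_congr rfl fun _ _ => by ring
      have h3 : ∏ i : Fin (k + 1), countSum (k + 1) N (shiftDeg (degInd (d + 1)) i) ≤
          Real.exp (-2) / (d.factorial : ℝ) := by
        rw [Fin.prod_univ_succ, shiftDeg_degInd_zero]
        refine (mul_le_of_le_one_right (countSum_nonneg _ _ (degInd_nonneg d)) ?_).trans (ih d)
        refine Finset.prod_le_one (fun i _ => ?_) fun i _ => ?_
        · exact countSum_nonneg _ _ (shiftDeg_nonneg (degInd_nonneg _) _)
        · rw [shiftDeg_of_ne _ (Fin.succ_ne_zero i)]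
          exact countSum_le_one_of ih
      have h4 : (1 : ℝ) ≤ k.factorial := by exact_mod_cast Nat.one_le_iff_ne_zero.mpr k.factorial_ne_zero
      have h5 := countSum_nonneg (k + 1) (N + 1) (degInd_nonneg (d + 1))
      rw [h2] at h1
      rw [Nat.factorial_succ, Nat.cast_mul, mul_comm, ← div_div, le_div_iff₀ (by positivity)]
      push_cast
      nlinarith [mul_nonneg (by positivity : (0 : ℝ) ≤ (d : ℝ) + 1) h5]

/-- The generating function of rooted hypertrees converges at `e⁻²`. -/
lemma summable_treeCount (k : ℕ) (hk : 1 ≤ k) :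
    (Summable fun n : ℕ => Real.exp (-2) ^ n / (n.factorial : ℝ) *
      treeCount (k + 1) n fun _ => 1) ∧
    ∑' n : ℕ, Real.exp (-2) ^ n / (n.factorial : ℝ) * (treeCount (k + 1) n fun _ => 1) ≤ 1 := by
  have h0 : ∀ n : ℕ, 0 ≤ Real.exp (-2) ^ n / (n.factorial : ℝ) *
      treeCount (k + 1) n fun _ => 1 := fun n =>
    mul_nonneg (by positivity) (treeCount_nonneg _ _ fun _ => zero_le_one)
  have h1 : ∀ n, ∑ i ∈ Finset.range n, Real.exp (-2) ^ i / (i.factorial : ℝ) *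
      (treeCount (k + 1) i fun _ => 1) ≤ 1 := fun n => by
    refine le_trans ?_ (countSum_le_one_of (countSum_degInd_le k hk n))
    exact Finset.sum_le_sum_of_subset_of_nonneg
      (Finset.range_subset_range.mpr n.le_succ) fun i _ _ => h0 i
  exact ⟨summable_of_sum_range_le h0 h1, Real.tsum_le_of_sum_range_le h0 h1⟩

lemma norm_le_of_mem_De {z : ℂ} (hz : z ∈ De) : ‖z‖ ≤ Real.exp (-2) := by
  simpa [De] using hz

lemma norm_pow_div_factorial_le {z : ℂ} (hz : z ∈ De) (n : ℕ) :
    ‖z ^ n / (n.factorial : ℂ)‖ ≤ Real.exp (-2) ^ n / (n.factorial : ℝ) := by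
  rw [norm_div, norm_pow, Complex.norm_natCast]
  exact div_le_div_of_nonneg_right
    (pow_le_pow_left₀ (norm_nonneg _) (norm_le_of_mem_De hz) n) (by positivity)

/-- The generating function of the weights of rooted hypertrees. -/
def treeSeries (q : ℕ) (z : ℂ) (χ : ℕ → ℝ) (ψ : ℝ × ℝ → ℝ) : ℂ :=
  ∑' n : ℕ, z ^ n / (n.factorial : ℂ) * (treeWeight q n χ ψ : ℂ)

lemma norm_treeSeries_term_le {q : ℕ} {z : ℂ} (hz : z ∈ De) {χ : ℕ → ℝ} (h0 : ∀ d, 0 ≤ χ d)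
    (h1 : ∀ d, χ d ≤ 1) {ψ : ℝ × ℝ → ℝ} (hψ : ∀ x, |ψ x| ≤ 1) (n : ℕ) :
    ‖z ^ n / (n.factorial : ℂ) * (treeWeight q n χ ψ : ℂ)‖ ≤
      Real.exp (-2) ^ n / (n.factorial : ℝ) * treeCount q n fun _ => 1 := by
  rw [norm_mul, Complex.norm_real]
  exact mul_le_mul (norm_pow_div_factorial_le hz n)
    ((abs_treeWeight_le q n h0 hψ).trans (treeCount_le_one q n h1)) (norm_nonneg _) (by positivity)

lemma summable_norm_treeSeries {k : ℕ} (hk : 1 ≤ k) {z : ℂ} (hz : z ∈ De) {χ : ℕ → ℝ}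
    (h0 : ∀ d, 0 ≤ χ d) (h1 : ∀ d, χ d ≤ 1) {ψ : ℝ × ℝ → ℝ} (hψ : ∀ x, |ψ x| ≤ 1) :
    Summable fun n : ℕ => ‖z ^ n / (n.factorial : ℂ) * (treeWeight (k + 1) n χ ψ : ℂ)‖ :=
  (summable_treeCount k hk).1.of_nonneg_of_le (fun _ => norm_nonneg _)
    (norm_treeSeries_term_le hz h0 h1 hψ)

lemma norm_treeSeries_le_one {k : ℕ} (hk : 1 ≤ k) {z : ℂ} (hz : z ∈ De) {χ : ℕ → ℝ}
    (h0 : ∀ d, 0 ≤ χ d) (h1 : ∀ d, χ d ≤ 1) {ψ : ℝ × ℝ → ℝ} (hψ : ∀ x, |ψ x| ≤ 1) :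
    ‖treeSeries (k + 1) z χ ψ‖ ≤ 1 :=
  (tsum_of_norm_bounded (summable_treeCount k hk).1.hasSum
    (norm_treeSeries_term_le hz h0 h1 hψ)).trans (summable_treeCount k hk).2

lemma measurable_treeSeries {α : Type*} [MeasurableSpace α] {k : ℕ} (hk : 1 ≤ k) {z : ℂ}
    (hz : z ∈ De) {χ : ℕ → ℝ} (h0 : ∀ d, 0 ≤ χ d) (h1 : ∀ d, χ d ≤ 1) {ψ : α → ℝ × ℝ → ℝ}
    (hψm : Measurable fun x : α × (ℝ × ℝ) => ψ x.1 x.2) (hψ : ∀ a x, |ψ a x| ≤ 1) :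
    Measurable fun a => treeSeries (k + 1) z χ (ψ a) := by
  refine measurable_of_tendsto_metrizable (f := fun N a => ∑ n ∈ Finset.range N,
    z ^ n / (n.factorial : ℂ) * (treeWeight (k + 1) n χ (ψ a) : ℂ)) (fun N => ?_) ?_
  · exact Finset.measurable_sum _ fun n _ =>
      (Complex.measurable_ofReal.comp (measurable_treeWeight _ n χ hψm)).const_mul _
  · rw [tendsto_pi_nhds]
    exact fun a => (Summable.of_norm
      (summable_norm_treeSeries hk hz h0 h1 (hψ a))).hasSum.tendsto_sum_nat

lemma treeSeries_degInd_zero {q : ℕ} (hq : 2 ≤ q) (z : ℂ) (ψ : ℝ × ℝ → ℝ) :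
    treeSeries q z (degInd 0) ψ = z := by
  rw [treeSeries, tsum_eq_single 1]
  · simp [treeWeight_degInd_zero hq]
  · intro n hn
    simp [treeWeight_degInd_zero hq, hn]

lemma hasSum_treeSeries_degInd {k : ℕ} (hk : 1 ≤ k) {z : ℂ} (hz : z ∈ De) {ψ : ℝ × ℝ → ℝ}
    (hψ : ∀ x, |ψ x| ≤ 1) :
    HasSum (fun d => treeSeries (k + 1) z (degInd d) ψ) (treeSeries (k + 1) z (fun _ => 1) ψ) := by
  set f : ℕ × ℕ → ℂ := fun p =>
    z ^ p.1 / (p.1.factorial : ℂ) * (treeWeight (k + 1) p.1 (degInd p.2) ψ : ℂ) with hf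
  set g : ℕ × ℕ → ℝ := fun p =>
    Real.exp (-2) ^ p.1 / (p.1.factorial : ℝ) * treeCount (k + 1) p.1 (degInd p.2) with hg
  have hg1 : ∀ n, HasSum (fun d => g (n, d)) (Real.exp (-2) ^ n / (n.factorial : ℝ) *
      treeCount (k + 1) n fun _ => 1) := fun n => (hasSum_treeCount _ n).mul_left _
  have hgs : Summable g := by
    refine (summable_prod_of_nonneg fun p => ?_).mpr ⟨fun n => (hg1 n).summable, ?_⟩
    · exact mul_nonneg (by positivity) (treeCount_nonneg _ _ (degInd_nonneg _))
    · simpa only [(hg1 _).tsum_eq] using (summable_treeCount k hk).1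
  have hfs : Summable f := hgs.of_norm_bounded fun p => by
    rw [hf, norm_mul, Complex.norm_real]
    exact mul_le_mul (norm_pow_div_factorial_le hz p.1)
      (abs_treeWeight_le _ _ (degInd_nonneg _) hψ) (norm_nonneg _) (by positivity)
  have h1 : HasSum f (treeSeries (k + 1) z (fun _ => 1) ψ) := by
    have := hfs.hasSum.prod_fiberwise fun n =>
      (Complex.hasSum_ofReal.mpr (hasSum_treeWeight (k + 1) n ψ)).mul_left
        (z ^ n / (n.factorial : ℂ))
    rw [treeSeries, this.tsum_eq]
    exact hfs.hasSum
  have h2 : HasSum (fun p : ℕ × ℕ => f p.swap) (treeSeries (k + 1) z (fun _ => 1) ψ) :=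
    (Equiv.prodComm ℕ ℕ).hasSum_iff.mpr h1
  exact h2.prod_fiberwise fun d => (Summable.of_norm
    (summable_norm_treeSeries hk hz (degInd_nonneg d) (degInd_le_one d) hψ)).hasSum

/-- Removing a hyperedge at the root, for generating functions. -/
lemma hasSum_treeWeight_rec {k : ℕ} (hk : 1 ≤ k) {z : ℂ} (hz : z ∈ De) {χ : ℕ → ℝ}
    (h0 : ∀ d, 0 ≤ χ d) (h1 : ∀ d, χ d ≤ 1) {ψ : ℝ × ℝ → ℝ} (hψm : Measurable ψ)
    (hψ : ∀ x, |ψ x| ≤ 1) :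
    HasSum (fun n : ℕ => z ^ n / (n.factorial : ℂ) *
        ((k.factorial : ℂ) * (treeWeight (k + 1) n (fun d => d * χ d) ψ : ℂ)))
      (∫ y, (ψ y : ℂ) *
        ∏ i : Fin (k + 1), treeSeries (k + 1) z (shiftDeg χ i) (chordWeight ψ y i) ∂nu) := by
  have hterm : ∀ n : ℕ, z ^ n / (n.factorial : ℂ) *
      ((k.factorial : ℂ) * (treeWeight (k + 1) n (fun d => d * χ d) ψ : ℂ)) =
      ∫ y, (ψ y : ℂ) * (z ^ n / (n.factorial : ℂ) * ∑ c : Fin n → Fin (k + 1),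
        ∏ i, (treeWeight (k + 1) (fib c i).card (shiftDeg χ i) (chordWeight ψ y i) : ℂ)) ∂nu := by
    intro n
    have := congrArg (fun r : ℝ => (r : ℂ)) (treeWeight_rec k n hk χ hψm hψ)
    simp only [Complex.ofReal_mul, Complex.ofReal_natCast] at this
    rw [this, ← integral_complex_ofReal, ← integral_const_mul]
    refine integral_congr_ae (Eventually.of_forall fun y => ?_)
    push_cast
    ring
  simp only [hterm]
  have hcs : ∀ i : Fin (k + 1), Summable fun n : ℕ =>
      ‖Real.exp (-2) ^ n / (n.factorial : ℝ) * treeCount (k + 1) n (shiftDeg χ i)‖ := fun i => by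
    refine (summable_treeCount k hk).1.of_nonneg_of_le (fun _ => norm_nonneg _) fun n => ?_
    have hc := treeCount_nonneg (k + 1) n (shiftDeg_nonneg h0 i)
    rw [Real.norm_of_nonneg (mul_nonneg (by positivity) hc)]
    exact mul_le_mul_of_nonneg_left (treeCount_le_one _ n (shiftDeg_le_one h1 i)) (by positivity)
  have hbs := Summable.of_norm (tsum_coloured
    (fun (i : Fin (k + 1)) n => treeCount (k + 1) n (shiftDeg χ i)) (Real.exp (-2)) hcs).1
  refine hasSum_integral_of_dominated_convergence (fun n _ => Real.exp (-2) ^ n /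
    (n.factorial : ℝ) * ∑ c : Fin n → Fin (k + 1),
      ∏ i, treeCount (k + 1) (fib c i).card (shiftDeg χ i)) (fun n => ?_)
    (fun n => Eventually.of_forall fun y => ?_) (Eventually.of_forall fun _ => hbs)
    (integrable_const _) (Eventually.of_forall fun y => ?_)
  · refine Measurable.aestronglyMeasurable ?_
    refine (Complex.measurable_ofReal.comp hψm).mul (Measurable.const_mul ?_ _)
    exact Finset.measurable_sum _ fun c _ => Finset.measurable_prod _ fun i _ =>
      Complex.measurable_ofReal.comp (measurable_treeWeight _ _ _ (measurable_chordWeight hψm i))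
  · rw [norm_mul, norm_mul, Complex.norm_real]
    refine (mul_le_of_le_one_left (by positivity) (hψ y)).trans ?_
    refine mul_le_mul (norm_pow_div_factorial_le hz n) ?_ (norm_nonneg _) (by positivity)
    refine (norm_sum_le _ _).trans (Finset.sum_le_sum fun c _ => ?_)
    rw [norm_prod]
    refine Finset.prod_le_prod (fun i _ => norm_nonneg _) fun i _ => ?_
    rw [Complex.norm_real]
    exact abs_treeWeight_le _ _ (shiftDeg_nonneg h0 i) (abs_chordWeight_le hψ y i)
  · obtain ⟨hs1, hs2⟩ := tsum_coloured
      (fun (i : Fin (k + 1)) n => (treeWeight (k + 1) n (shiftDeg χ i) (chordWeight ψ y i) : ℂ)) z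
      fun i => summable_norm_treeSeries hk hz (shiftDeg_nonneg h0 i) (shiftDeg_le_one h1 i)
        (abs_chordWeight_le hψ y i)
    have := (Summable.of_norm hs1).hasSum.mul_left (ψ y : ℂ)
    rw [hs2] at this
    exact this

/-- The cavity function: the generating function of hypertrees whose root carries an extra
hyperedge with chord `y`. -/
def cavity (q : ℕ) (z : ℂ) (y : ℝ × ℝ) : ℂ := treeSeries q z (fun _ => 1) (K y)

lemma norm_cavity_le_one {k : ℕ} (hk : 1 ≤ k) {z : ℂ} (hz : z ∈ De) (y : ℝ × ℝ) :
    ‖cavity (k + 1) z y‖ ≤ 1 :=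
  norm_treeSeries_le_one hk hz (fun _ => zero_le_one) (fun _ => le_rfl) fun x => (abs_K y x).le

lemma measurable_cavity {k : ℕ} (hk : 1 ≤ k) {z : ℂ} (hz : z ∈ De) :
    Measurable (cavity (k + 1) z) :=
  measurable_treeSeries hk hz (fun _ => zero_le_one) (fun _ => le_rfl) measurable_K
    fun y x => (abs_K y x).le

lemma chordWeight_of_ne {k : ℕ} (ψ : ℝ × ℝ → ℝ) (y : ℝ × ℝ) {i : Fin (k + 1)} (hi : i ≠ 0) :
    chordWeight ψ y i = K y := by
  funext x
  simp [chordWeight, hi]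

lemma chordWeight_zero {k : ℕ} (ψ : ℝ × ℝ → ℝ) (y : ℝ × ℝ) :
    chordWeight ψ y (0 : Fin (k + 1)) = fun x => ψ x * K y x := by
  funext x
  simp [chordWeight]

lemma treeSeries_degInd_succ {k : ℕ} (hk : 1 ≤ k) {z : ℂ} (hz : z ∈ De) (d : ℕ)
    {ψ : ℝ × ℝ → ℝ} (hψm : Measurable ψ) (hψ : ∀ x, |ψ x| ≤ 1) :
    ((d + 1 : ℕ) : ℂ) * treeSeries (k + 1) z (degInd (d + 1)) ψ =
      ∫ y, (ψ y : ℂ) * (cavity (k + 1) z y ^ k / (k.factorial : ℂ)) *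
        treeSeries (k + 1) z (degInd d) (fun x => ψ x * K y x) ∂nu := by
  have h := hasSum_treeWeight_rec hk hz (degInd_nonneg (d + 1)) (degInd_le_one (d + 1)) hψm hψ
  have hk0 : (k.factorial : ℂ) ≠ 0 := Nat.cast_ne_zero.mpr k.factorial_ne_zero
  have hL : ∀ n : ℕ, z ^ n / (n.factorial : ℂ) * ((k.factorial : ℂ) *
      (treeWeight (k + 1) n (fun m => m * degInd (d + 1) m) ψ : ℂ)) =
      ((k.factorial : ℂ) * ((d + 1 : ℕ) : ℂ)) * (z ^ n / (n.factorial : ℂ) *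
        (treeWeight (k + 1) n (degInd (d + 1)) ψ : ℂ)) := fun n => by
    have : treeWeight (k + 1) n (fun m => m * degInd (d + 1) m) ψ =
        ((d + 1 : ℕ) : ℝ) * treeWeight (k + 1) n (degInd (d + 1)) ψ := by
      simp only [treeWeight, mul_degInd, Finset.mul_sum, mul_assoc]
    rw [this]
    push_cast
    ring
  have hR : ∀ y, (ψ y : ℂ) * ∏ i : Fin (k + 1),
      treeSeries (k + 1) z (shiftDeg (degInd (d + 1)) i) (chordWeight ψ y i) =
      (k.factorial : ℂ) * ((ψ y : ℂ) * (cavity (k + 1) z y ^ k / (k.factorial : ℂ)) *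
        treeSeries (k + 1) z (degInd d) (fun x => ψ x * K y x)) := fun y => by
    rw [Fin.prod_univ_succ, shiftDeg_degInd_zero, chordWeight_zero]
    have : ∀ i : Fin k, treeSeries (k + 1) z (shiftDeg (degInd (d + 1)) i.succ)
        (chordWeight ψ y i.succ) = cavity (k + 1) z y := fun i => by
      rw [shiftDeg_of_ne _ (Fin.succ_ne_zero i), chordWeight_of_ne _ _ (Fin.succ_ne_zero i), cavity]
    simp only [this, Finset.prod_const, Finset.card_univ, Fintype.card_fin]
    field_simp
  simp only [hL, hR] at h
  rw [integral_const_mul] at h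
  have h2 := h.tsum_eq
  rw [tsum_mul_left, mul_assoc] at h2
  exact mul_left_cancel₀ hk0 h2

lemma pairProd_zero (y : Fin 0 → ℝ × ℝ) : pairProd 0 y = 1 := by
  simp [pairProd]

lemma pairProd_eq (d : ℕ) (y : Fin d → ℝ × ℝ) :
    pairProd d y = ∏ i, ∏ j, if i < j then K (y i) (y j) else 1 := by
  rw [pairProd, Finset.prod_filter, Fintype.prod_prod_type]

lemma pairProd_cons (d : ℕ) (x : ℝ × ℝ) (y : Fin d → ℝ × ℝ) :
    pairProd (d + 1) (Fin.cons x y : Fin (d + 1) → ℝ × ℝ) = (∏ j, K x (y j)) * pairProd d y := by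
  rw [pairProd_eq, pairProd_eq, Fin.prod_univ_succ]
  congr 1
  · rw [Fin.prod_univ_succ]
    simp
  · refine Finset.prod_congr rfl fun i _ => ?_
    rw [Fin.prod_univ_succ]
    simp

lemma abs_pairProd (d : ℕ) (y : Fin d → ℝ × ℝ) : |pairProd d y| = 1 := by
  rw [pairProd, Finset.abs_prod]
  exact Finset.prod_eq_one fun p _ => abs_K _ _

lemma measurable_pairProd (d : ℕ) : Measurable (pairProd d) :=
  Finset.measurable_prod _ fun p _ =>
    measurable_K_comp (measurable_pi_apply p.1) (measurable_pi_apply p.2)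

/-- The integrals over `d` interacting chords occurring in the cavity equation. -/
def gasTerm (g : ℝ × ℝ → ℂ) (ψ : ℝ × ℝ → ℝ) (d : ℕ) : ℂ :=
  ∫ y : Fin d → ℝ × ℝ, (∏ i, ((ψ (y i) : ℂ) * g (y i))) * (pairProd d y : ℂ)
    ∂(Measure.pi fun _ => nu)

lemma norm_gasTerm_integrand_le {g : ℝ × ℝ → ℂ} (hg : ∀ x, ‖g x‖ ≤ 1) {ψ : ℝ × ℝ → ℝ}
    (hψ : ∀ x, |ψ x| ≤ 1) (d : ℕ) (y : Fin d → ℝ × ℝ) :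
    ‖(∏ i, ((ψ (y i) : ℂ) * g (y i))) * (pairProd d y : ℂ)‖ ≤ 1 := by
  rw [norm_mul, Complex.norm_real, Real.norm_eq_abs, abs_pairProd, mul_one, norm_prod]
  refine Finset.prod_le_one (fun _ _ => norm_nonneg _) fun i _ => ?_
  rw [norm_mul, Complex.norm_real]
  exact mul_le_one₀ (hψ _) (norm_nonneg _) (hg _)

lemma measurable_gasTerm_integrand {g : ℝ × ℝ → ℂ} (hgm : Measurable g) {ψ : ℝ × ℝ → ℝ}
    (hψm : Measurable ψ) (d : ℕ) :
    Measurable fun y : Fin d → ℝ × ℝ =>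
      (∏ i, ((ψ (y i) : ℂ) * g (y i))) * (pairProd d y : ℂ) := by
  refine Measurable.mul (Finset.measurable_prod _ fun i _ => ?_)
    (Complex.measurable_ofReal.comp (measurable_pairProd d))
  exact (Complex.measurable_ofReal.comp (hψm.comp (measurable_pi_apply i))).mul
    (hgm.comp (measurable_pi_apply i))

lemma integrable_gasTerm_integrand {g : ℝ × ℝ → ℂ} (hgm : Measurable g) (hg : ∀ x, ‖g x‖ ≤ 1)
    {ψ : ℝ × ℝ → ℝ} (hψm : Measurable ψ) (hψ : ∀ x, |ψ x| ≤ 1) (d : ℕ) :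
    Integrable (fun y : Fin d → ℝ × ℝ =>
      (∏ i, ((ψ (y i) : ℂ) * g (y i))) * (pairProd d y : ℂ)) (Measure.pi fun _ => nu) :=
  Integrable.of_bound (measurable_gasTerm_integrand hgm hψm d).aestronglyMeasurable 1
    (Eventually.of_forall (norm_gasTerm_integrand_le hg hψ d))

lemma gasTerm_zero (g : ℝ × ℝ → ℂ) (ψ : ℝ × ℝ → ℝ) : gasTerm g ψ 0 = 1 := by
  simp [gasTerm, pairProd_zero]

lemma gasTerm_succ {g : ℝ × ℝ → ℂ} (hgm : Measurable g) (hg : ∀ x, ‖g x‖ ≤ 1)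
    {ψ : ℝ × ℝ → ℝ} (hψm : Measurable ψ) (hψ : ∀ x, |ψ x| ≤ 1) (d : ℕ) :
    gasTerm g ψ (d + 1) =
      ∫ x, (ψ x : ℂ) * g x * gasTerm g (fun y => ψ y * K x y) d ∂nu := by
  have hmp := (measurePreserving_piFinSuccAbove (fun _ : Fin (d + 1) => nu) 0).symm
  rw [gasTerm, ← hmp.integral_comp', integral_prod]
  · refine integral_congr_ae (Eventually.of_forall fun x => ?_)
    simp only
    rw [gasTerm, ← integral_const_mul]
    refine integral_congr_ae (Eventually.of_forall fun y => ?_)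
    have : (MeasurableEquiv.piFinSuccAbove (fun _ : Fin (d + 1) => ℝ × ℝ) 0).symm (x, y) =
        (Fin.cons x y : Fin (d + 1) → ℝ × ℝ) := by
      simp [MeasurableEquiv.piFinSuccAbove]
      rfl
    simp only [this, pairProd_cons, Fin.prod_univ_succ, Fin.cons_zero, Fin.cons_succ]
    push_cast
    simp only [Finset.prod_mul_distrib]
    ring
  · exact (hmp.integrable_comp_emb (MeasurableEquiv.measurableEmbedding _)).mpr
      (integrable_gasTerm_integrand hgm hg hψm hψ (d + 1))

lemma norm_prod_sub_prod_le {ι : Type*} (s : Finset ι) (a b : ι → ℂ) (ha : ∀ i, ‖a i‖ ≤ 1)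
    (hb : ∀ i, ‖b i‖ ≤ 1) : ‖∏ i ∈ s, a i - ∏ i ∈ s, b i‖ ≤ ∑ i ∈ s, ‖a i - b i‖ := by
  induction s using Finset.cons_induction with
  | empty => simp
  | cons i s hi ih =>
    rw [Finset.prod_cons, Finset.prod_cons, Finset.sum_cons]
    have h1 : a i * ∏ j ∈ s, a j - b i * ∏ j ∈ s, b j =
        (a i - b i) * ∏ j ∈ s, a j + b i * (∏ j ∈ s, a j - ∏ j ∈ s, b j) := by ring
    have h2 : ‖∏ j ∈ s, a j‖ ≤ 1 := by
      rw [norm_prod]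
      exact Finset.prod_le_one (fun _ _ => norm_nonneg _) fun j _ => ha j
    rw [h1]
    refine (norm_add_le _ _).trans (add_le_add ?_ ?_)
    · rw [norm_mul]
      exact mul_le_of_le_one_right (norm_nonneg _) h2
    · rw [norm_mul]
      exact (mul_le_of_le_one_left (norm_nonneg _) (hb i)).trans ih

lemma norm_gasTerm_le {g : ℝ × ℝ → ℂ} (hg : ∀ x, ‖g x‖ ≤ 1) {ψ : ℝ × ℝ → ℝ}
    (hψ : ∀ x, |ψ x| ≤ 1) (d : ℕ) : ‖gasTerm g ψ d‖ ≤ 1 := by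
  have := norm_integral_le_of_norm_le_const (μ := Measure.pi fun _ : Fin d => nu)
    (Eventually.of_forall (norm_gasTerm_integrand_le hg hψ d))
  simpa [gasTerm] using this

lemma norm_gasTerm_sub_le {g h : ℝ × ℝ → ℂ} (hgm : Measurable g) (hg : ∀ x, ‖g x‖ ≤ 1)
    (hhm : Measurable h) (hh : ∀ x, ‖h x‖ ≤ 1) {δ : ℝ} (hδ : ∀ x, ‖g x - h x‖ ≤ δ)
    {ψ : ℝ × ℝ → ℝ} (hψm : Measurable ψ) (hψ : ∀ x, |ψ x| ≤ 1) (d : ℕ) :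
    ‖gasTerm g ψ d - gasTerm h ψ d‖ ≤ d * δ := by
  rw [gasTerm, gasTerm, ← integral_sub (integrable_gasTerm_integrand hgm hg hψm hψ d)
    (integrable_gasTerm_integrand hhm hh hψm hψ d)]
  have hb : ∀ f : ℝ × ℝ → ℂ, (∀ x, ‖f x‖ ≤ 1) → ∀ x, ‖(ψ x : ℂ) * f x‖ ≤ 1 := fun f hf x => by
    rw [norm_mul, Complex.norm_real]
    exact mul_le_one₀ (hψ _) (norm_nonneg _) (hf _)
  have key := norm_integral_le_of_norm_le_const (μ := Measure.pi fun _ : Fin d => nu)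
    (f := fun y => (∏ i, ((ψ (y i) : ℂ) * g (y i))) * (pairProd d y : ℂ) -
      (∏ i, ((ψ (y i) : ℂ) * h (y i))) * (pairProd d y : ℂ)) (C := d * δ)
    (Eventually.of_forall fun y => ?_)
  · simpa using key
  · rw [← sub_mul, norm_mul, Complex.norm_real, Real.norm_eq_abs, abs_pairProd, mul_one]
    refine (norm_prod_sub_prod_le _ _ _ (fun i => hb g hg _) fun i => hb h hh _).trans ?_
    refine (Finset.sum_le_card_nsmul _ _ δ fun i _ => ?_).trans_eq (by simp)
    rw [← mul_sub, norm_mul, Complex.norm_real]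
    exact (mul_le_of_le_one_left (norm_nonneg _) (hψ _)).trans (hδ _)

/-- The activity `f ^ k / k!` of a function `f`. -/
def activity (k : ℕ) (f : ℝ × ℝ → ℂ) (x : ℝ × ℝ) : ℂ := f x ^ k / (k.factorial : ℂ)

lemma measurable_activity {k : ℕ} {f : ℝ × ℝ → ℂ} (hf : Measurable f) :
    Measurable (activity k f) := (hf.pow_const k).div_const _

lemma norm_activity_le_one (k : ℕ) {f : ℝ × ℝ → ℂ} (hf : ∀ x, ‖f x‖ ≤ 1) (x : ℝ × ℝ) :
    ‖activity k f x‖ ≤ 1 := by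
  have h4 : (1 : ℝ) ≤ k.factorial := by
    exact_mod_cast Nat.one_le_iff_ne_zero.mpr k.factorial_ne_zero
  rw [activity, norm_div, norm_pow, Complex.norm_natCast]
  exact div_le_one_of_le₀ ((pow_le_one₀ (norm_nonneg _) (hf x)).trans h4) (by positivity)

lemma norm_activity_sub_le (k : ℕ) {f g : ℝ × ℝ → ℂ} (hf : ∀ x, ‖f x‖ ≤ 1)
    (hg : ∀ x, ‖g x‖ ≤ 1) (x : ℝ × ℝ) :
    ‖activity k f x - activity k g x‖ ≤ ‖f x - g x‖ := by
  have h1 := norm_prod_sub_prod_le (Finset.univ : Finset (Fin k)) (fun _ => f x) (fun _ => g x)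
    (fun _ => hf x) fun _ => hg x
  simp only [Finset.prod_const, Finset.sum_const, Finset.card_univ, Fintype.card_fin,
    nsmul_eq_mul] at h1
  rw [activity, activity, ← sub_div, norm_div, Complex.norm_natCast, div_le_iff₀ (by positivity),
    mul_comm]
  refine h1.trans (mul_le_mul_of_nonneg_right ?_ (norm_nonneg _))
  exact_mod_cast Nat.self_le_factorial k

lemma treeSeries_degInd {k : ℕ} (hk : 1 ≤ k) {z : ℂ} (hz : z ∈ De) (d : ℕ) :
    ∀ {ψ : ℝ × ℝ → ℝ}, Measurable ψ → (∀ x, |ψ x| ≤ 1) →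
      treeSeries (k + 1) z (degInd d) ψ =
        z * ((d.factorial : ℂ)⁻¹ * gasTerm (activity k (cavity (k + 1) z)) ψ d) := by
  induction d with
  | zero =>
    intro ψ _ _
    simp [treeSeries_degInd_zero (show 2 ≤ k + 1 by omega), gasTerm_zero]
  | succ d ih =>
    intro ψ hψm hψ
    have h1 := treeSeries_degInd_succ hk hz d hψm hψ
    have hd : ((d + 1 : ℕ) : ℂ) ≠ 0 := Nat.cast_ne_zero.mpr d.succ_ne_zero
    have hf : (d.factorial : ℂ) ≠ 0 := Nat.cast_ne_zero.mpr d.factorial_ne_zero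
    refine mul_left_cancel₀ hd (h1.trans ?_)
    rw [gasTerm_succ (measurable_activity (measurable_cavity hk hz))
      (norm_activity_le_one k (norm_cavity_le_one hk hz)) hψm hψ, Nat.factorial_succ]
    have h2 : ((d + 1 : ℕ) : ℂ) * (z * ((((d + 1) * d.factorial : ℕ) : ℂ)⁻¹ *
        ∫ x, (ψ x : ℂ) * activity k (cavity (k + 1) z) x *
          gasTerm (activity k (cavity (k + 1) z)) (fun y => ψ y * K x y) d ∂nu)) =
        (z * (d.factorial : ℂ)⁻¹) * ∫ x, (ψ x : ℂ) * activity k (cavity (k + 1) z) x *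
          gasTerm (activity k (cavity (k + 1) z)) (fun y => ψ y * K x y) d ∂nu := by
      rw [Nat.cast_mul]
      field_simp
    rw [h2, ← integral_const_mul]
    refine integral_congr_ae (Eventually.of_forall fun y => ?_)
    have h3 : Measurable fun x => ψ x * K y x :=
      hψm.mul (measurable_K_comp measurable_const measurable_id)
    have h4 : ∀ x, |ψ x * K y x| ≤ 1 := fun x => by
      rw [abs_mul, abs_K, mul_one]
      exact hψ x
    simp only
    rw [ih h3 h4, activity]
    ring

lemma hasSum_gasTerm {k : ℕ} (hk : 1 ≤ k) {z : ℂ} (hz : z ∈ De) {ψ : ℝ × ℝ → ℝ}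
    (hψm : Measurable ψ) (hψ : ∀ x, |ψ x| ≤ 1) :
    HasSum (fun d : ℕ =>
        z * ((d.factorial : ℂ)⁻¹ * gasTerm (activity k (cavity (k + 1) z)) ψ d))
      (treeSeries (k + 1) z (fun _ => 1) ψ) := by
  simpa only [treeSeries_degInd hk hz _ hψm hψ] using hasSum_treeSeries_degInd hk hz hψ

/-- The sum over all numbers of chords, as in the definitions of `Tcal` and `Rcal`. -/
lemma treeSeries_eq {k : ℕ} (hk : 1 ≤ k) {z : ℂ} (hz : z ∈ De) {ψ : ℝ × ℝ → ℝ}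
    (hψm : Measurable ψ) (hψ : ∀ x, |ψ x| ≤ 1) :
    treeSeries (k + 1) z (fun _ => 1) ψ = z + z * ∑' d : ℕ, ((d + 1).factorial : ℂ)⁻¹ *
      gasTerm (activity k (cavity (k + 1) z)) ψ (d + 1) := by
  have h := hasSum_gasTerm hk hz hψm hψ
  rw [← h.tsum_eq, h.summable.tsum_eq_zero_add, tsum_mul_left]
  simp [gasTerm_zero]

lemma ae_pi_mem_Omega (d : ℕ) :
    ∀ᵐ y ∂(Measure.pi fun _ : Fin d => nu), ∀ i, y i ∈ Omega :=
  ae_all_iff.mpr fun i => (Measure.quasiMeasurePreserving_eval (fun _ : Fin d => nu) i).ae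
    ae_mem_Omega

/-- A measurable extension of the cavity equation's solution beyond `Omega`. -/
def extendFrom (f g : ℝ × ℝ → ℂ) (x : ℝ × ℝ) : ℂ := if x ∈ Omega then f x else g x

lemma measurable_extendFrom {f g : ℝ × ℝ → ℂ} (hf : ContinuousOn f Omega) (hg : Measurable g) :
    Measurable (extendFrom f g) := by
  have hO : MeasurableSet Omega := measurableSet_Icc.prod measurableSet_Icc
  refine measurable_of_restrict_of_restrict_compl hO ?_ ?_
  · have : Omega.domRestrict (extendFrom f g) = Omega.domRestrict f := by
      funext x
      simp [extendFrom, Set.domRestrict, x.2]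
    rw [this]
    exact (continuousOn_iff_continuous_domRestrict.mp hf).measurable
  · have : Omegaᶜ.domRestrict (extendFrom f g) = Omegaᶜ.domRestrict g := by
      funext x
      have hx : (x : ℝ × ℝ) ∉ Omega := x.2
      simp [extendFrom, Set.domRestrict, hx]
    rw [this]
    exact hg.comp measurable_subtype_coe

lemma gasTerm_congr {g h : ℝ × ℝ → ℂ} (hgh : ∀ x ∈ Omega, g x = h x) (ψ : ℝ × ℝ → ℝ) (d : ℕ) :
    gasTerm g ψ d = gasTerm h ψ d := by
  refine integral_congr_ae ?_
  filter_upwards [ae_pi_mem_Omega d] with y hy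
  simp only [hgh _ (hy _)]

lemma Tterm_eq (k : ℕ) (G : ℂ → ℝ × ℝ → ℂ) (z : ℂ) (x : ℝ × ℝ) (d : ℕ) :
    Tterm (k + 1) G z x d = (d.factorial : ℂ)⁻¹ * gasTerm (activity k (G z)) (K x) d := by
  simp only [Tterm, gasTerm, activity, Nat.add_sub_cancel, mul_div_assoc]

lemma Rterm_eq (k : ℕ) (G : ℂ → ℝ × ℝ → ℂ) (z : ℂ) (d : ℕ) :
    Rterm (k + 1) G z d = (d.factorial : ℂ)⁻¹ * gasTerm (activity k (G z)) (fun _ => 1) d := by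
  simp only [Rterm, gasTerm, activity, Nat.add_sub_cancel, Complex.ofReal_one, one_mul]

lemma hasSum_inv_factorial : HasSum (fun d : ℕ => ((d.factorial : ℝ))⁻¹) (Real.exp 1) := by
  have := NormedSpace.expSeries_div_hasSum_exp (𝔸 := ℝ) (1 : ℝ)
  rw [← Real.exp_eq_exp_ℝ] at this
  simpa only [one_pow, one_div] using this

/-- The right-hand side of the cavity equation. -/
def cavityMap (k : ℕ) (z : ℂ) (f : ℝ × ℝ → ℂ) (x : ℝ × ℝ) : ℂ :=
  z + z * ∑' d : ℕ, ((d + 1).factorial : ℂ)⁻¹ * gasTerm (activity k f) (K x) (d + 1)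

lemma summable_gasTerm {g : ℝ × ℝ → ℂ} (hg : ∀ x, ‖g x‖ ≤ 1) {ψ : ℝ × ℝ → ℝ}
    (hψ : ∀ x, |ψ x| ≤ 1) :
    Summable fun d : ℕ => ((d + 1).factorial : ℂ)⁻¹ * gasTerm g ψ (d + 1) := by
  refine ((summable_nat_add_iff 1).mpr hasSum_inv_factorial.summable).of_norm_bounded fun d => ?_
  rw [norm_mul, norm_inv, Complex.norm_natCast]
  exact mul_le_of_le_one_right (by positivity) (norm_gasTerm_le hg hψ _)

lemma measurable_K_left (x : ℝ × ℝ) : Measurable (K x) :=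
  measurable_K_comp measurable_const measurable_id

/-- The cavity equation is a contraction. -/
lemma norm_cavityMap_sub_le (k : ℕ) {z : ℂ} (hz : z ∈ De) {f g : ℝ × ℝ → ℂ}
    (hfm : Measurable f) (hf : ∀ x, ‖f x‖ ≤ 1) (hgm : Measurable g) (hg : ∀ x, ‖g x‖ ≤ 1)
    {δ : ℝ} (hδ : ∀ x, ‖f x - g x‖ ≤ δ) (x : ℝ × ℝ) :
    ‖cavityMap k z f x - cavityMap k z g x‖ ≤ Real.exp (-1) * δ := by
  have hf1 := norm_activity_le_one k hf
  have hg1 := norm_activity_le_one k hg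
  have hK : ∀ y, |K x y| ≤ 1 := fun y => (abs_K x y).le
  have h1 : cavityMap k z f x - cavityMap k z g x = z * ∑' d : ℕ,
      (((d + 1).factorial : ℂ)⁻¹ * gasTerm (activity k f) (K x) (d + 1) -
        ((d + 1).factorial : ℂ)⁻¹ * gasTerm (activity k g) (K x) (d + 1)) := by
    rw [(summable_gasTerm hf1 hK).tsum_sub (summable_gasTerm hg1 hK), cavityMap, cavityMap]
    ring
  have h2 : ‖∑' d : ℕ,
      (((d + 1).factorial : ℂ)⁻¹ * gasTerm (activity k f) (K x) (d + 1) -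
        ((d + 1).factorial : ℂ)⁻¹ * gasTerm (activity k g) (K x) (d + 1))‖ ≤
      Real.exp 1 * δ := by
    refine tsum_of_norm_bounded (hasSum_inv_factorial.mul_right δ) fun d => ?_
    rw [← mul_sub, norm_mul, norm_inv, Complex.norm_natCast]
    have h3 := norm_gasTerm_sub_le (measurable_activity (k := k) hfm) hf1 (measurable_activity hgm)
      hg1 (fun y => (norm_activity_sub_le k hf hg y).trans (hδ y)) (measurable_K_left x) hK (d + 1)
    refine (mul_le_mul_of_nonneg_left h3 (by positivity)).trans_eq ?_
    rw [Nat.factorial_succ]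
    have : ((d + 1 : ℕ) : ℝ) ≠ 0 := Nat.cast_ne_zero.mpr d.succ_ne_zero
    have : (d.factorial : ℝ) ≠ 0 := Nat.cast_ne_zero.mpr d.factorial_ne_zero
    push_cast at *
    field_simp
  rw [h1, norm_mul]
  refine (mul_le_mul (norm_le_of_mem_De hz) h2 (norm_nonneg _) (by positivity)).trans_eq ?_
  rw [← mul_assoc, ← Real.exp_add]
  norm_num

lemma cavity_eq {k : ℕ} (hk : 1 ≤ k) {z : ℂ} (hz : z ∈ De) (x : ℝ × ℝ) :
    cavity (k + 1) z x = cavityMap k z (cavity (k + 1) z) x :=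
  treeSeries_eq hk hz (measurable_K_left x) fun y => (abs_K x y).le

lemma IsCCG.eq_cavity {k : ℕ} (hk : 1 ≤ k) {H : ℂ → ℝ × ℝ → ℂ} (hH : IsCCG (k + 1) H) {z : ℂ}
    (hz : z ∈ De) {x : ℝ × ℝ} (hx : x ∈ Omega) : H z x = cavity (k + 1) z x := by
  obtain ⟨⟨hcont, hbound⟩, hfix⟩ := hH
  set C := cavity (k + 1) z with hC
  set h := extendFrom (H z) C with hh
  have hCm : Measurable C := measurable_cavity hk hz
  have hC1 : ∀ y, ‖C y‖ ≤ 1 := norm_cavity_le_one hk hz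
  have hhm : Measurable h := by
    refine measurable_extendFrom ?_ hCm
    exact hcont.comp (f := fun y => (z, y)) (by fun_prop) fun y hy => Set.mk_mem_prod hz hy
  have hHh : ∀ y ∈ Omega, H z y = h y := fun y hy => by simp [hh, extendFrom, hy]
  have hh1 : ∀ y, ‖h y‖ ≤ 1 := fun y => by
    by_cases hy : y ∈ Omega
    · rw [← hHh y hy]
      exact hbound z hz y hy
    · simpa [hh, extendFrom, hy] using hC1 y
  have hmap : ∀ y ∈ Omega, h y = cavityMap k z h y := fun y hy => by
    rw [← hHh y hy, hfix z hz y hy, Tcal, cavityMap]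
    simp only [Tterm_eq]
    simp only [gasTerm_congr (g := activity k (H z)) (h := activity k h)
      fun w hw => by simp only [activity, hHh w hw]]
  have hiter : ∀ m : ℕ, ∀ y, ‖h y - C y‖ ≤ Real.exp (-1) ^ m * 2 := fun m => by
    induction m with
    | zero =>
      intro y
      have := norm_sub_le (h y) (C y)
      linarith [hh1 y, hC1 y]
    | succ m ih =>
      intro y
      by_cases hy : y ∈ Omega
      · rw [hmap y hy, hC, cavity_eq hk hz y, pow_succ', mul_assoc]
        exact norm_cavityMap_sub_le k hz hhm hh1 hCm hC1 ih y
      · have : h y = C y := by simp [hh, extendFrom, hy]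
        rw [this, sub_self, norm_zero]
        positivity
  have hlim : Tendsto (fun m : ℕ => Real.exp (-1) ^ m * 2) atTop (nhds (0 * 2)) :=
    (tendsto_pow_atTop_nhds_zero_of_lt_one (Real.exp_pos _).le
      (Real.exp_lt_one_iff.mpr (by norm_num))).mul_const 2
  have h0 := ge_of_tendsto' hlim fun m => hiter m x
  rw [zero_mul] at h0
  rw [hHh x hx]
  exact sub_eq_zero.mp (norm_le_zero_iff.mp h0)

lemma sum_rootedOn_succ (q v : ℕ) (F : Finset (Finset (Fin (v + 1))) → ℝ) :
    ∑ p ∈ rootedOn q (Finset.univ : Finset (Fin (v + 1))), F p.2 =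
      ∑ E ∈ trees q (v + 1), ((v + 1 : ℕ) : ℝ) * F E := by
  rw [rootedOn, Finset.sum_product, ← trees_succ]
  simp [Finset.mul_sum]

lemma treeWeight_zero (q : ℕ) (χ : ℕ → ℝ) (ψ : ℝ × ℝ → ℝ) : treeWeight q 0 χ ψ = 0 :=
  Finset.sum_eq_zero fun p _ => p.1.elim0

lemma treeWeight_one_succ (q v : ℕ) :
    treeWeight q (v + 1) (fun _ => 1) (fun _ => 1) =
      ∑ E ∈ trees q (v + 1), ((v + 1 : ℕ) : ℝ) * bT E := by
  rw [← sum_rootedOn_succ, treeWeight]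
  simp only [one_mul, rootWeight_one]

/-- Summing the root degree over all roots counts each hyperedge `q` times. -/
lemma sum_rootDeg_eq {q n : ℕ} {E : Finset (Finset (Fin n))} (hE : ∀ e ∈ E, e.card = q) :
    ∑ r, rootDeg (r, E) = q * E.card := by
  simp only [rootDeg, Finset.card_filter]
  rw [Finset.sum_comm]
  simp only [← Finset.card_filter]
  rw [Finset.sum_congr rfl fun e he => by
    rw [Finset.filter_univ_mem, hE e he], Finset.sum_const, smul_eq_mul, mul_comm]

lemma treeWeight_rootDeg_succ {q : ℕ} (hq : 2 ≤ q) (v : ℕ) :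
    treeWeight q (v + 1) (fun d => d * 1) (fun _ => 1) =
      q * ∑ E ∈ trees q (v + 1), ((v / (q - 1) : ℕ) : ℝ) * bT E := by
  rw [treeWeight, rootedOn, Finset.sum_product_right, ← trees_succ, Finset.mul_sum]
  refine Finset.sum_congr rfl fun E hE => ?_
  obtain ⟨h1, -, h2⟩ : IsHypertree q (v + 1) E := by simpa [trees] using hE
  simp only [rootWeight_one, mul_one]
  rw [← Finset.sum_mul, ← Nat.cast_sum, sum_rootDeg_eq h1, Nat.cast_mul, mul_assoc]
  have : v / (q - 1) = E.card := by
    rw [Nat.add_sub_cancel] at h2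
    exact Nat.div_eq_of_eq_mul_right (by omega) h2.symm
  rw [this]

lemma Rcal_eq {k : ℕ} (hk : 1 ≤ k) {H : ℂ → ℝ × ℝ → ℂ} (hH : IsCCG (k + 1) H) {z : ℂ}
    (hz : z ∈ De) :
    Rcal (k + 1) H z = ∑' v : ℕ, (z ^ (v + 1) / ((v + 1).factorial : ℂ)) *
      ∑ E ∈ trees (k + 1) (v + 1), ((v + 1 : ℕ) : ℂ) * (bT E : ℂ) := by
  have hψ : ∀ x : ℝ × ℝ, |(fun _ : ℝ × ℝ => (1 : ℝ)) x| ≤ 1 := fun _ => by simp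
  have h1 : Rcal (k + 1) H z = treeSeries (k + 1) z (fun _ => 1) fun _ => 1 := by
    rw [treeSeries_eq hk hz measurable_const hψ, Rcal]
    simp only [Rterm_eq]
    simp only [gasTerm_congr (g := activity k (H z)) (h := activity k (cavity (k + 1) z))
      fun w hw => by simp only [activity, hH.eq_cavity hk hz hw]]
  have hs := Summable.of_norm (summable_norm_treeSeries hk hz (χ := fun _ => 1)
    (fun _ => zero_le_one) (fun _ => le_rfl) hψ)
  rw [h1, treeSeries, hs.tsum_eq_zero_add, treeWeight_zero, Complex.ofReal_zero, mul_zero, zero_add]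
  refine tsum_congr fun v => ?_
  rw [treeWeight_one_succ]
  push_cast
  rfl

lemma Ecal_eq {k : ℕ} (hk : 1 ≤ k) {H : ℂ → ℝ × ℝ → ℂ} (hH : IsCCG (k + 1) H) {z : ℂ}
    (hz : z ∈ De) :
    Ecal (k + 1) H z = ∑' v : ℕ, (z ^ (v + 1) / ((v + 1).factorial : ℂ)) *
      ∑ E ∈ trees (k + 1) (v + 1), ((v / (k + 1 - 1) : ℕ) : ℂ) * (bT E : ℂ) := by
  have hψ : ∀ x : ℝ × ℝ, |(fun _ : ℝ × ℝ => (1 : ℝ)) x| ≤ 1 := fun _ => by simp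
  have h := hasSum_treeWeight_rec hk hz (χ := fun _ => 1) (fun _ => zero_le_one)
    (fun _ => le_rfl) measurable_const hψ
  have hshift : ∀ i : Fin (k + 1), shiftDeg (fun _ => 1) i = fun _ => 1 := fun i => by
    funext d
    simp [shiftDeg]
  have hchord : ∀ (y : ℝ × ℝ) (i : Fin (k + 1)), chordWeight (fun _ => 1) y i = K y := fun y i => by
    funext x
    simp [chordWeight]
  have hinteg : ∫ y, (((1 : ℝ) : ℂ)) * ∏ i : Fin (k + 1), treeSeries (k + 1) z
      (shiftDeg (fun _ => 1) i) (chordWeight (fun _ => 1) y i) ∂nu =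
      ∫ x, H z x ^ (k + 1) ∂nu := by
    refine integral_congr_ae ?_
    filter_upwards [ae_mem_Omega] with y hy
    simp only [hshift, hchord, hH.eq_cavity hk hz hy, cavity, Finset.prod_const, Finset.card_univ,
      Fintype.card_fin, Complex.ofReal_one, one_mul]
  rw [hinteg] at h
  have hq0 : ((k + 1).factorial : ℂ) ≠ 0 := Nat.cast_ne_zero.mpr (k + 1).factorial_ne_zero
  rw [Ecal, ← h.tsum_eq, h.summable.tsum_eq_zero_add, treeWeight_zero, Complex.ofReal_zero,
    mul_zero, mul_zero, zero_add, ← tsum_mul_left]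
  refine tsum_congr fun v => ?_
  rw [treeWeight_rootDeg_succ (by omega), inv_mul_eq_iff_eq_mul₀ hq0, Nat.factorial_succ k]
  push_cast
  ring

/-- The tree expansions of `ℛ` and `ℰ`:
`ℛ(z) = Σ_{v≥1} (z^v/v!) Σ_{T ∈ 𝒯_v} v b_T` and
`ℰ(z) = Σ_{v≥1} (z^v/v!) Σ_{T ∈ 𝒯_v} ((v−1)/(q−1)) b_T` on `{|z| ≤ e⁻²}`. -/
theorem Rcal_Ecal_tree_expansion (q : ℕ) (hq : Even q) (hq2 : 2 ≤ q)
    (H : ℂ → ℝ × ℝ → ℂ) (hH : IsCCG q H) :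
    ∀ z ∈ De,
      Rcal q H z = (∑' v : ℕ, (z ^ (v + 1) / ((v + 1).factorial : ℂ)) *
          ∑ E ∈ trees q (v + 1), ((v + 1 : ℕ) : ℂ) * (bT E : ℂ)) ∧
      Ecal q H z = ∑' v : ℕ, (z ^ (v + 1) / ((v + 1).factorial : ℂ)) *
          ∑ E ∈ trees q (v + 1), ((v / (q - 1) : ℕ) : ℂ) * (bT E : ℂ) := by
  obtain ⟨k, rfl⟩ : ∃ k, q = k + 1 := ⟨q - 1, by omega⟩
  exact fun z hz => ⟨Rcal_eq (by omega) hH hz, Ecal_eq (by omega) hH hz⟩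

end SYK
end
end

section
/- For every even integer q ≥ 2 there exists β* > 0 such that for every real β with |β| ≤ β*: sup_{n ≥ 1} sup_{|z| ≤ 2} |B(z)| ≤ 1 and sup_{n ≥ 1} sup_{|z| ≤ 2} |B'(z)| ≤ 1, where B = B^{(n)} is the polynomial B(z) = n Σ_{1 ≤ v ≤ n, Δ ≥ 1} μ_{v,Δ} z^v (in particular, for each n the sum over Δ ≥ 1 converges absolutely). -/
open MeasureTheory Filter

noncomputable section

namespace SYK

attribute [local instance] Classical.propDecidable

/-- The quadratic form on `ℂ^N` with `Q(x) = ½ Σ x_i²`, so that the Clifford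
relation reads `ψ_i ψ_j + ψ_j ψ_i = δ_{ij}`. -/
def Qf (N : ℕ) : QuadraticForm ℂ (Fin N → ℂ) :=
  QuadraticMap.weightedSumSquares ℂ (fun _ : Fin N => (1 / 2 : ℂ))

/-- The complex Clifford algebra with `N` Majorana generators. -/
abbrev Cliff (N : ℕ) := CliffordAlgebra (Qf N)

/-- The Majorana generator `ψ_i`. -/
def psi {N : ℕ} (i : Fin N) : Cliff N :=
  CliffordAlgebra.ι (Qf N) (Pi.single i 1)

/-- `ψ_I = i^{q/2} ψ_{i₁} ⋯ ψ_{i_q}` for `I = {i₁ < ⋯ < i_q}`. -/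
def psiSet {N : ℕ} (q : ℕ) (I : Finset (Fin N)) : Cliff N :=
  (Complex.I) ^ (q / 2) • ((I.sort (· ≤ ·)).map psi).prod

/-- The sign `B(I₁,…,I_m) ∈ {±1}` determined by
`ψ_{I₁} ⋯ ψ_{I_m} = B(I₁,…,I_m) 2^{-qm/2} 1`. -/
def signB {N : ℕ} (q : ℕ) (l : List (Finset (Fin N))) : ℝ :=
  if (l.map (psiSet q)).prod = (((2 : ℂ) ^ (q * l.length / 2))⁻¹) • (1 : Cliff N) then 1 else -1

/-- `b(H) = Σ_{(I₁,…,I_m) ∈ w(H)} B(I₁,…,I_m)` for a multi-hypergraph with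
multiplicity function `r` and total multiplicity `m`, the sum running over
all ordered sequences in which each hyperedge `e` appears exactly `r e` times. -/
def bMulti {N : ℕ} (q : ℕ) (r : Finset (Fin N) → ℕ) (m : ℕ) : ℝ :=
  ∑ f : Fin m → Finset (Fin N),
    if (∀ e, (Finset.univ.filter (fun i => f i = e)).card = r e)
    then signB q (List.ofFn f) else 0

/-- `r` describes a member of `ℋ_{v,Δ}`: a connected `q`-uniform multi-hypergraph on the
vertex set `{1,…,v}` with even multiplicities and total multiplicity `2(v−1+Δ)/(q−1)`. -/
def IsMultiHG (q v Δ : ℕ) (r : Finset (Fin v) → ℕ) : Prop :=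
  (∀ e, r e ≠ 0 → e.card = q) ∧ (∀ e, Even (r e)) ∧
    (∀ a b : Fin v,
      Relation.ReflTransGen (fun a b => ∃ e, r e ≠ 0 ∧ a ∈ e ∧ b ∈ e) a b) ∧
    (q - 1) * (∑ e, r e) = 2 * (v - 1 + Δ)

/-- `σ = ((q−1)!/n^{q−1})^{1/2}`. -/
def sigma (q n : ℕ) : ℝ := Real.sqrt ((q - 1).factorial / (n : ℝ) ^ (q - 1))

/-- `μ_{v,Δ} = (n^{v−1}/v!) Σ_{H ∈ ℋ_{v,Δ}} (β 2^{-q/2} σ)^{m(H)} b(H)/m(H)!`.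
Multi-hypergraphs are encoded by their multiplicity functions; since the total
multiplicity is at most `2(v−1+Δ)`, multiplicities are encoded in `Fin (2(v−1+Δ)+1)`. -/
def muVD (q n : ℕ) (β : ℝ) (v Δ : ℕ) : ℝ :=
  (n : ℝ) ^ (v - 1) / v.factorial *
    ∑ r : Finset (Fin v) → Fin (2 * (v - 1 + Δ) + 1),
      if IsMultiHG q v Δ (fun e => (r e : ℕ)) then
        (β * ((2 : ℝ) ^ (q / 2))⁻¹ * sigma q n) ^ (∑ e, (r e : ℕ)) *
          bMulti q (fun e => (r e : ℕ)) (∑ e, (r e : ℕ)) / (∑ e, (r e : ℕ)).factorial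
      else 0

/-- `B(z) = n Σ_{1 ≤ v ≤ n, Δ ≥ 1} μ_{v,Δ} z^v`. -/
def Bpoly (q n : ℕ) (β : ℝ) (z : ℂ) : ℂ :=
  (n : ℂ) * ∑ v ∈ Finset.Icc 1 n, ∑' Δ : ℕ, (muVD q n β v (Δ + 1) : ℂ) * z ^ v

/-- The sequences of length `m` with entries in `S` in which every value appears an even number
of times. -/
def evenSeqs {α : Type*} [Fintype α] (S : Finset α) (m : ℕ) : Finset (Fin m → α) :=
  Finset.univ.filter fun f =>
    (∀ i, f i ∈ S) ∧ ∀ e, Even (Finset.univ.filter (fun i => f i = e)).card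

/-- In a sequence with even multiplicities the first entry reappears later; deleting both
occurrences leaves a shorter sequence with even multiplicities. -/
lemma card_evenSeqs_add_two_le {α : Type*} [Fintype α] (S : Finset α) (m : ℕ) :
    (evenSeqs S (m + 2)).card ≤ S.card * (m + 1) * (evenSeqs S m).card := by
  have hsub : evenSeqs S (m + 2) ⊆
      (S ×ˢ (Finset.univ : Finset (Fin (m + 1))) ×ˢ evenSeqs S m).image
        (fun p => (Fin.cons p.1 (p.2.1.insertNth p.1 p.2.2 : Fin (m + 1) → α) :
          Fin (m + 2) → α)) := by
    intro f hf
    simp only [evenSeqs, Finset.mem_filter, Finset.mem_univ, true_and] at hf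
    obtain ⟨hS, hev⟩ := hf
    obtain ⟨j, hj⟩ : ∃ j : Fin (m + 1), f j.succ = f 0 := by
      by_contra! h
      have h1 := hev (f 0)
      rw [Finset.card_filter, Fin.sum_univ_succ] at h1
      simp [h] at h1
    have hfj : f = (Fin.cons (f 0)
        (j.insertNth (f 0) (fun i => f (j.succAbove i).succ) : Fin (m + 1) → α) :
          Fin (m + 2) → α) := by
      funext i
      refine Fin.cases rfl (fun i => ?_) i
      rw [Fin.cons_succ]
      rcases Fin.eq_self_or_eq_succAbove j i with rfl | ⟨i, rfl⟩
      · simp [hj]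
      · simp
    refine Finset.mem_image.2 ⟨(f 0, j, fun i => f (j.succAbove i).succ), ?_, hfj.symm⟩
    simp only [Finset.mem_product, Finset.mem_univ, true_and, evenSeqs, Finset.mem_filter]
    refine ⟨hS 0, fun i => hS _, fun e => ?_⟩
    have h1 := hev e
    rw [Finset.card_filter, Fin.sum_univ_succ, Fin.sum_univ_succAbove _ j, hj] at h1
    rw [Finset.card_filter]
    by_cases he : f 0 = e
    · simp only [he, if_true] at h1
      rw [← add_assoc, Nat.even_add] at h1
      exact h1.1 (by decide)
    · simpa only [he, if_false, zero_add] using h1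
  calc (evenSeqs S (m + 2)).card ≤ _ := Finset.card_le_card hsub
    _ ≤ _ := Finset.card_image_le
    _ = _ := by simp [mul_assoc]

lemma card_evenSeqs_mul_factorial_le {α : Type*} [Fintype α] (S : Finset α) (k : ℕ) :
    (evenSeqs S (2 * k)).card * k.factorial ≤ S.card ^ k * (2 * k).factorial := by
  induction k with
  | zero =>
    have : (evenSeqs S (2 * 0)).card ≤ 1 := Finset.card_le_one.2 fun f _ g _ =>
      funext fun i => absurd i.2 (by omega)
    simpa using this
  | succ k ih =>
    rw [show 2 * (k + 1) = 2 * k + 2 by ring]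
    calc (evenSeqs S (2 * k + 2)).card * (k + 1).factorial
        ≤ (S.card * (2 * k + 1) * (evenSeqs S (2 * k)).card) * (k + 1).factorial :=
          Nat.mul_le_mul_right _ (card_evenSeqs_add_two_le S (2 * k))
      _ = (S.card * (2 * k + 1) * (k + 1)) * ((evenSeqs S (2 * k)).card * k.factorial) := by
          rw [Nat.factorial_succ]; ring
      _ ≤ (S.card * (2 * k + 1) * (2 * k + 2)) * (S.card ^ k * (2 * k).factorial) := by
          gcongr <;> omega
      _ = S.card ^ (k + 1) * (2 * k + 2).factorial := by
          rw [Nat.factorial_succ, Nat.factorial_succ]; ring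

lemma abs_bMulti_le {N : ℕ} (q : ℕ) (r : Finset (Fin N) → ℕ) (m : ℕ) :
    |bMulti q r m| ≤ ∑ f : Fin m → Finset (Fin N),
      if (∀ e, (Finset.univ.filter (fun i => f i = e)).card = r e) then (1 : ℝ) else 0 := by
  refine (Finset.abs_sum_le_sum_abs _ _).trans (Finset.sum_le_sum fun f _ => ?_)
  split_ifs with h
  · unfold signB
    split_ifs <;> simp
  · simp

/-- The sum of `|b(H)|` over `ℋ_{v,Δ}`, whose members have total multiplicity `2k`, is at most
the number of sequences of `2k` hyperedges with even multiplicities. -/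
lemma sum_abs_bMulti_le (q v Δ M k : ℕ) :
    (∑ r : Finset (Fin v) → Fin M,
      if IsMultiHG q v Δ (fun e => (r e : ℕ)) then
        |bMulti q (fun e => (r e : ℕ)) (2 * k)| else 0) ≤
      (evenSeqs (Finset.powersetCard q (Finset.univ : Finset (Fin v))) (2 * k)).card := by
  calc _ ≤ ∑ r : Finset (Fin v) → Fin M, ∑ f : Fin (2 * k) → Finset (Fin v),
        if IsMultiHG q v Δ (fun e => (r e : ℕ)) ∧
          (∀ e, (Finset.univ.filter (fun i => f i = e)).card = r e) then (1 : ℝ) else 0 := by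
        refine Finset.sum_le_sum fun r _ => ?_
        split_ifs with h
        · simpa only [h, true_and] using abs_bMulti_le q (fun e => (r e : ℕ)) (2 * k)
        · exact Finset.sum_nonneg fun f _ => by split_ifs <;> norm_num
    _ = ∑ f : Fin (2 * k) → Finset (Fin v), ∑ r : Finset (Fin v) → Fin M,
        if IsMultiHG q v Δ (fun e => (r e : ℕ)) ∧
          (∀ e, (Finset.univ.filter (fun i => f i = e)).card = r e) then (1 : ℝ) else 0 :=
        Finset.sum_comm
    _ ≤ ∑ f : Fin (2 * k) → Finset (Fin v),
        if f ∈ evenSeqs (Finset.powersetCard q (Finset.univ : Finset (Fin v))) (2 * k)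
          then (1 : ℝ) else 0 := by
        refine Finset.sum_le_sum fun f _ => ?_
        rw [Finset.sum_boole]
        split_ifs with hf
        · refine Nat.cast_le_one.2 (Finset.card_le_one.2 fun r hr s hs => ?_)
          simp only [Finset.mem_filter, Finset.mem_univ, true_and] at hr hs
          funext e
          exact Fin.ext ((hr.2 e).symm.trans (hs.2 e))
        · refine le_of_eq (Nat.cast_eq_zero.2 (Finset.card_eq_zero.2
            (Finset.filter_eq_empty_iff.2 fun r _ hr => hf ?_)))
          obtain ⟨⟨hcard, heven, -, -⟩, hcount⟩ := hr
          simp only [evenSeqs, Finset.mem_filter, Finset.mem_univ, true_and,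
            Finset.mem_powersetCard_univ]
          refine ⟨fun i => hcard _ ?_, fun e => ?_⟩
          · change (r (f i) : ℕ) ≠ 0
            rw [← hcount]
            exact Finset.card_ne_zero_of_mem (Finset.mem_filter.2 ⟨Finset.mem_univ i, rfl⟩)
          · convert heven e
            convert hcount e
    _ = _ := by rw [Finset.sum_boole, Finset.filter_univ_mem]

lemma abs_muVD_eq_zero_or_le (q n : ℕ) (β : ℝ) (v Δ : ℕ) (hq2 : 2 ≤ q) :
    muVD q n β v Δ = 0 ∨ ∃ k : ℕ, (q - 1) * k = v - 1 + Δ ∧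
      |muVD q n β v Δ| ≤ (n : ℝ) ^ (v - 1) / v.factorial *
        ((β ^ 2 * ((q - 1).factorial / (n : ℝ) ^ (q - 1))) ^ k *
          ((v : ℝ) ^ (q * k) / k.factorial)) := by
  by_cases hex : ∃ r : Finset (Fin v) → Fin (2 * (v - 1 + Δ) + 1),
      IsMultiHG q v Δ (fun e => (r e : ℕ))
  swap
  · left
    unfold muVD
    rw [Finset.sum_eq_zero fun r _ => if_neg fun h => hex ⟨r, h⟩, mul_zero]
  right
  obtain ⟨r₀, -, heven, -, htot⟩ := hex
  obtain ⟨k, hk⟩ : Even (∑ e, (r₀ e : ℕ)) := Finset.even_sum _ fun e _ => heven e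
  have hkv : (q - 1) * k = v - 1 + Δ := by
    rw [hk] at htot
    have : 2 * ((q - 1) * k) = 2 * (v - 1 + Δ) := by rw [← htot]; ring
    omega
  refine ⟨k, hkv, ?_⟩
  have hm : ∀ r : Finset (Fin v) → Fin (2 * (v - 1 + Δ) + 1),
      IsMultiHG q v Δ (fun e => (r e : ℕ)) → ∑ e, (r e : ℕ) = 2 * k := by
    rintro r ⟨-, -, -, h⟩
    refine Nat.eq_of_mul_eq_mul_left (show 0 < q - 1 by omega) ?_
    rw [h, ← hkv]; ring
  set a : ℝ := β * ((2 : ℝ) ^ (q / 2))⁻¹ * sigma q n with ha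
  have ha2 : a ^ 2 ≤ β ^ 2 * ((q - 1).factorial / (n : ℝ) ^ (q - 1)) := by
    have h1 : (((2 : ℝ) ^ (q / 2))⁻¹) ^ 2 ≤ 1 :=
      pow_le_one₀ (by positivity) (inv_le_one_of_one_le₀ (one_le_pow₀ (by norm_num)))
    have h2 : sigma q n ^ 2 = (q - 1).factorial / (n : ℝ) ^ (q - 1) :=
      Real.sq_sqrt (by positivity)
    rw [ha, mul_pow, mul_pow, h2]
    gcongr
    exact mul_le_of_le_one_right (sq_nonneg β) h1
  have hE : ((evenSeqs (Finset.powersetCard q (Finset.univ : Finset (Fin v))) (2 * k)).card : ℝ) /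
      (2 * k).factorial ≤ (v : ℝ) ^ (q * k) / k.factorial := by
    rw [div_le_div_iff₀ (by positivity) (by positivity)]
    refine (by exact_mod_cast card_evenSeqs_mul_factorial_le _ k :
      _ ≤ ((Finset.powersetCard q (Finset.univ : Finset (Fin v))).card : ℝ) ^ k *
        (2 * k).factorial).trans ?_
    rw [pow_mul]
    gcongr
    rw [Finset.card_powersetCard, Finset.card_fin]
    exact_mod_cast Nat.choose_le_pow v q
  unfold muVD
  rw [abs_mul, abs_of_nonneg (by positivity : (0 : ℝ) ≤ (n : ℝ) ^ (v - 1) / v.factorial)]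
  refine mul_le_mul_of_nonneg_left ?_ (by positivity)
  calc _ ≤ ∑ r : Finset (Fin v) → Fin (2 * (v - 1 + Δ) + 1),
        (a ^ 2) ^ k / (2 * k).factorial * (if IsMultiHG q v Δ (fun e => (r e : ℕ)) then
        |bMulti q (fun e => (r e : ℕ)) (2 * k)| else 0) := by
        refine (Finset.abs_sum_le_sum_abs _ _).trans (Finset.sum_le_sum fun r _ => ?_)
        split_ifs with h
        · rw [hm r h, abs_div, abs_mul, Nat.abs_cast, pow_mul, abs_of_nonneg
            (by positivity : (0 : ℝ) ≤ (a ^ 2) ^ k)]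
          exact le_of_eq (by ring)
        · simp
    _ = (a ^ 2) ^ k / (2 * k).factorial * ∑ r : Finset (Fin v) → Fin (2 * (v - 1 + Δ) + 1),
        (if IsMultiHG q v Δ (fun e => (r e : ℕ)) then
        |bMulti q (fun e => (r e : ℕ)) (2 * k)| else 0) := by rw [Finset.mul_sum]
    _ ≤ (a ^ 2) ^ k / (2 * k).factorial *
        (evenSeqs (Finset.powersetCard q (Finset.univ : Finset (Fin v))) (2 * k)).card := by
        gcongr
        exact sum_abs_bMulti_le q v Δ _ k
    _ = (a ^ 2) ^ k * ((evenSeqs (Finset.powersetCard q (Finset.univ : Finset (Fin v)))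
        (2 * k)).card / (2 * k).factorial) := by ring
    _ ≤ _ := by gcongr

lemma natCast_mul_abs_muVD_le {q n : ℕ} {β ε : ℝ} {v : ℕ} (Δ : ℕ) (hq2 : 2 ≤ q)
    (hε : 0 ≤ ε) (hβ : β ^ 2 * (q - 1).factorial ≤ ε ^ (q - 1)) (hv : 1 ≤ v) (hvn : v ≤ n) :
    (n : ℝ) * |muVD q n β v (Δ + 1)| ≤ (8 * ε) ^ v * ε ^ Δ := by
  rcases abs_muVD_eq_zero_or_le q n β v (Δ + 1) hq2 with h0 | ⟨k, hk, hle⟩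
  · rw [h0, abs_zero, mul_zero]; positivity
  have hn : (0 : ℝ) < n := by exact_mod_cast hv.trans hvn
  have hvn' : (v : ℝ) ≤ n := by exact_mod_cast hvn
  have hexp : Real.exp v ^ 2 ≤ 8 ^ v := by
    rw [← Real.exp_nat_mul, mul_comm, Real.exp_nat_mul]
    gcongr
    have := Real.exp_one_lt_d9
    rw [show ((2 : ℕ) : ℝ) = 1 + 1 by norm_num, Real.exp_add]
    nlinarith [Real.exp_pos 1]
  have h1 : (v : ℝ) ^ v / v.factorial ≤ Real.exp v :=
    Real.pow_div_factorial_le_exp _ (by positivity) _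
  have h2 : (v : ℝ) ^ k / k.factorial ≤ Real.exp v :=
    Real.pow_div_factorial_le_exp _ (by positivity) _
  have hratio : (v / n : ℝ) ^ Δ ≤ 1 := pow_le_one₀ (by positivity) ((div_le_one hn).2 hvn')
  have hkv : (q - 1) * k = v + Δ := by omega
  have hqk : q * k = k + (v + Δ) := by
    rw [← hkv, ← one_add_mul]; congr 1; omega
  calc (n : ℝ) * |muVD q n β v (Δ + 1)|
      ≤ n * ((n : ℝ) ^ (v - 1) / v.factorial *
        ((β ^ 2 * ((q - 1).factorial / (n : ℝ) ^ (q - 1))) ^ k *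
          ((v : ℝ) ^ (q * k) / k.factorial))) := by gcongr
    _ = ((v : ℝ) ^ v / v.factorial) * ((v : ℝ) ^ k / k.factorial) *
        (β ^ 2 * (q - 1).factorial) ^ k * (v / n : ℝ) ^ Δ := by
        have hn1 : (n : ℝ) * n ^ (v - 1) = n ^ v := by
          rw [← pow_succ']; congr 1; omega
        rw [← mul_div_assoc (β ^ 2), div_pow, ← pow_mul, hkv, hqk, pow_add, pow_add, pow_add,
          div_pow]
        rw [← mul_assoc, ← mul_div_assoc, hn1]
        field_simp
    _ ≤ Real.exp v * Real.exp v * (ε ^ (q - 1)) ^ k * 1 := by gcongr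
    _ = Real.exp v ^ 2 * (ε ^ v * ε ^ Δ) := by rw [← pow_mul, hkv, pow_add]; ring
    _ ≤ 8 ^ v * (ε ^ v * ε ^ Δ) := by gcongr
    _ = (8 * ε) ^ v * ε ^ Δ := by rw [mul_pow]; ring

lemma sum_Icc_half_pow_le_one (n : ℕ) : ∑ v ∈ Finset.Icc 1 n, (1 / 2 : ℝ) ^ v ≤ 1 := by
  have h : ∑ v ∈ Finset.Icc 1 n, (1 / 2 : ℝ) ^ v = 1 - (1 / 2) ^ n := by
    induction n with
    | zero => simp
    | succ n ih => rw [Finset.sum_Icc_succ_top (by omega), ih]; ring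
  rw [h]
  linarith [pow_pos (show (0 : ℝ) < 1 / 2 by norm_num) n]

/-- A polynomial without constant term whose coefficients decay fast is bounded by one, together
with its derivative, on the disc of radius two. -/
lemma norm_sum_Icc_mul_pow_le_one {n : ℕ} {c : ℕ → ℂ}
    (hc : ∀ v ∈ Finset.Icc 1 n, ‖c v‖ ≤ (1 / 8) ^ v) {z : ℂ} (hz : ‖z‖ ≤ 2) :
    ‖∑ v ∈ Finset.Icc 1 n, c v * z ^ v‖ ≤ 1 ∧
      ‖deriv (fun z => ∑ v ∈ Finset.Icc 1 n, c v * z ^ v) z‖ ≤ 1 := by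
  constructor
  · refine (norm_sum_le_of_le _ fun v hv => ?_).trans (sum_Icc_half_pow_le_one n)
    rw [norm_mul, norm_pow]
    calc ‖c v‖ * ‖z‖ ^ v ≤ (1 / 8) ^ v * 2 ^ v := by gcongr; exact hc v hv
      _ = (1 / 4) ^ v := by rw [← mul_pow]; norm_num
      _ ≤ (1 / 2) ^ v := by gcongr; norm_num
  · have hd : HasDerivAt (fun z => ∑ v ∈ Finset.Icc 1 n, c v * z ^ v)
        (∑ v ∈ Finset.Icc 1 n, c v * (v * z ^ (v - 1))) z :=
      HasDerivAt.fun_sum fun v _ => (hasDerivAt_pow v z).const_mul (c v)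
    rw [hd.deriv]
    refine (norm_sum_le_of_le _ fun v hv => ?_).trans (sum_Icc_half_pow_le_one n)
    rw [norm_mul, norm_mul, norm_pow, Complex.norm_natCast]
    have hv2 : (v : ℝ) ≤ 2 ^ v := by exact_mod_cast Nat.lt_two_pow_self.le
    calc ‖c v‖ * (v * ‖z‖ ^ (v - 1)) ≤ (1 / 8) ^ v * (2 ^ v * 2 ^ v) := by
          gcongr
          · exact hc v hv
          · calc ‖z‖ ^ (v - 1) ≤ 2 ^ (v - 1) := by gcongr
              _ ≤ 2 ^ v := pow_le_pow_right₀ (by norm_num) (Nat.sub_le v 1)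
      _ = (1 / 2) ^ v := by rw [← mul_pow, ← mul_pow]; norm_num

/-- For small enough `β*` and `|β| ≤ β*`, the sums over `Δ ≥ 1` defining
`B = B^{(n)}` converge absolutely, and `sup_{n ≥ 1} sup_{|z| ≤ 2} |B(z)| ≤ 1` and
`sup_{n ≥ 1} sup_{|z| ≤ 2} |B'(z)| ≤ 1`. -/
theorem Bpoly_bounds (q : ℕ) (hq : Even q) (hq2 : 2 ≤ q) :
    ∃ βs : ℝ, 0 < βs ∧ ∀ β : ℝ, |β| ≤ βs → ∀ n : ℕ, 1 ≤ n →
      (∀ v ∈ Finset.Icc 1 n, Summable (fun Δ : ℕ => |muVD q n β v (Δ + 1)|)) ∧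
      (∀ z : ℂ, ‖z‖ ≤ 2 → ‖Bpoly q n β z‖ ≤ 1 ∧ ‖deriv (Bpoly q n β) z‖ ≤ 1) := by
  have hf : (0 : ℝ) < (q - 1).factorial := by positivity
  refine ⟨Real.sqrt ((1 / 1000) ^ (q - 1) / (q - 1).factorial), by positivity,
    fun β hβ n hn => ?_⟩
  have hβ2 : β ^ 2 * (q - 1).factorial ≤ (1 / 1000 : ℝ) ^ (q - 1) := by
    rw [← le_div_iff₀ hf, ← sq_abs]
    exact (Real.le_sqrt (abs_nonneg β) (by positivity)).1 hβ
  have hn0 : (0 : ℝ) < n := by exact_mod_cast hn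
  have hbound : ∀ v ∈ Finset.Icc 1 n, ∀ Δ : ℕ,
      (n : ℝ) * |muVD q n β v (Δ + 1)| ≤ (8 * (1 / 1000)) ^ v * (1 / 1000) ^ Δ := fun v hv Δ =>
    natCast_mul_abs_muVD_le Δ hq2 (by norm_num) hβ2 (Finset.mem_Icc.1 hv).1 (Finset.mem_Icc.1 hv).2
  have hgeom : HasSum (fun Δ : ℕ => (1 / 1000 : ℝ) ^ Δ) (1 - 1 / 1000)⁻¹ :=
    hasSum_geometric_of_lt_one (by norm_num) (by norm_num)
  have hsum : ∀ v ∈ Finset.Icc 1 n, Summable (fun Δ : ℕ => |muVD q n β v (Δ + 1)|) :=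
    fun v hv => (summable_mul_left_iff hn0.ne').1 <|
      Summable.of_nonneg_of_le (fun Δ => by positivity) (hbound v hv) (hgeom.mul_left _).summable
  refine ⟨hsum, fun z hz => ?_⟩
  have hB : Bpoly q n β = fun z => ∑ v ∈ Finset.Icc 1 n,
      (∑' Δ : ℕ, (n : ℂ) * (muVD q n β v (Δ + 1) : ℂ)) * z ^ v := by
    funext z
    unfold Bpoly
    rw [Finset.mul_sum]
    refine Finset.sum_congr rfl fun v _ => ?_
    rw [tsum_mul_right, tsum_mul_left, mul_assoc]
  rw [hB]
  refine norm_sum_Icc_mul_pow_le_one (fun v hv => ?_) hz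
  have h1 : ‖∑' Δ : ℕ, (n : ℂ) * (muVD q n β v (Δ + 1) : ℂ)‖ ≤
      (8 * (1 / 1000)) ^ v * (1 - 1 / 1000)⁻¹ := by
    refine tsum_of_norm_bounded (hgeom.mul_left _) fun Δ => ?_
    rw [norm_mul, Complex.norm_natCast, Complex.norm_real, Real.norm_eq_abs]
    exact hbound v hv Δ
  have hv0 : v ≠ 0 := by have := (Finset.mem_Icc.1 hv).1; omega
  calc _ ≤ (8 * (1 / 1000)) ^ v * (1 - 1 / 1000)⁻¹ := h1
    _ ≤ (8 * (1 / 1000) : ℝ) ^ v * 2 ^ v := by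
        gcongr
        exact (by norm_num : (1 - 1 / 1000 : ℝ)⁻¹ ≤ 2).trans
          (le_self_pow₀ (by norm_num) hv0)
    _ = (2 / 125) ^ v := by rw [← mul_pow]; norm_num
    _ ≤ (1 / 8) ^ v := pow_le_pow_left₀ (by norm_num) (by norm_num) v

end SYK
end
end
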